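/- (Jerison–Weitsman theorem for quasiregular maps.) Let n ≥ 2 and let f : B → ℝⁿ \ {0} be a K-quasiregular mapping in the Miniowitz class (Min) with constants C₀, α, satisfying the multiplicity condition (M) with exponent 0 ≤ a < n−1 and constant C₁. Then there exist p > 0 and C > 0, both depending only on n, K, a, α, C₀ and C₁, such that ‖f‖_{H^p} ≤ C·|f(0)|; in particular f belongs to the Hardy space H^p. -/

import Mathlib

open MeasureTheory Metric Set Filter
open scoped ENNReal NNReal Topology Classical

noncomputable section

abbrev Vec (n : ℕ) := EuclideanSpace ℝ (Fin n)

/-- The open unit ball in `ℝⁿ`. -/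
def unitBall (n : ℕ) : Set (Vec n) := Metric.ball 0 1

/-- The unit sphere `S^{n-1}` in `ℝⁿ`. -/
def unitSphere (n : ℕ) : Set (Vec n) := Metric.sphere 0 1

/-- Surface measure on the unit sphere, modelled by `(n-1)`-dimensional
Hausdorff measure restricted to the sphere. -/
def sphMeasure (n : ℕ) : Measure (Vec n) := (μH[(n : ℝ) - 1]).restrict (unitSphere n)

/-- `f` is `K`-quasiregular on the unit ball. -/
def IsQR (n : ℕ) (K : ℝ) (f : Vec n → Vec n) : Prop :=
  ContinuousOn f (unitBall n) ∧
  (∀ x ∈ unitBall n, DifferentiableAt ℝ f x) ∧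
  (∀ᵐ x ∂(volume.restrict (unitBall n)),
    ‖fderiv ℝ f x‖ ^ n ≤ K * (fderiv ℝ f x).det)

/-- The conformal automorphism `T_x` of the unit ball (with `T_0 = id`). -/
def mobiusT (n : ℕ) (x : Vec n) (y : Vec n) : Vec n :=
  if x = 0 then y
  else (‖x‖ ^ 2 * ‖y - (‖x‖ ^ 2)⁻¹ • x‖ ^ 2)⁻¹ •
    ((1 - ‖x‖ ^ 2) • (y - x) - ‖y - x‖ ^ 2 • x)

/-- The Miniowitz class (Min) with constants `C₀, α`. -/
def InMiniowitz (n : ℕ) (C₀ α : ℝ) (f : Vec n → Vec n) : Prop :=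
  ∀ x ∈ unitBall n, ∀ y ∈ unitBall n,
    C₀⁻¹ * ((1 - ‖y‖) / (1 + ‖y‖)) ^ α ≤ ‖f (mobiusT n (-x) y)‖ / ‖f (mobiusT n (-x) 0)‖ ∧
    ‖f (mobiusT n (-x) y)‖ / ‖f (mobiusT n (-x) 0)‖ ≤ C₀ * ((1 + ‖y‖) / (1 - ‖y‖)) ^ α

/-- The multiplicity condition (M) with exponent `a` and constant `C₁`. -/
def MultCond (n : ℕ) (a C₁ : ℝ) (f : Vec n → Vec n) : Prop :=
  ∀ x ∈ unitBall n, ∀ r : ℝ, 0 < r → r < 1 → ∀ y : Vec n,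
    (({z ∈ Metric.ball (0 : Vec n) r | f (mobiusT n (-x) z) = y}).encard : ℝ≥0∞) ≤
      ENNReal.ofReal (C₁ / (1 - r) ^ a)

/-- The non-tangential region `Γ(ω)` with aperture parameter `κ`. -/
def ntRegion (n : ℕ) (κ : ℝ) (ω : Vec n) : Set (Vec n) :=
  {x ∈ unitBall n | ‖x - ω‖ < (1 + κ) * (1 - ‖x‖)}

/-- The non-tangential maximal function `f*`. -/
def ntMax (n : ℕ) (κ : ℝ) (f : Vec n → Vec n) (ω : Vec n) : ℝ≥0∞ :=
  ⨆ x ∈ ntRegion n κ ω, ENNReal.ofReal ‖f x‖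

/-- `f` has the non-tangential limit `L` at `ω`. -/
def HasNTLimit (n : ℕ) (κ : ℝ) (f : Vec n → Vec n) (ω L : Vec n) : Prop :=
  Filter.Tendsto f (𝓝[ntRegion n κ ω] ω) (𝓝 L)

/-- The `p`-th mean of `f` on the sphere of radius `r`. -/
def hardyMean (n : ℕ) (p : ℝ) (f : Vec n → Vec n) (r : ℝ) : ℝ≥0∞ :=
  (sphMeasure n (unitSphere n))⁻¹ *
    ∫⁻ ω, ENNReal.ofReal (‖f (r • ω)‖ ^ p) ∂(sphMeasure n)

/-- The Hardy `H^p` norm of `f` on the unit ball. -/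
def hardyNorm (n : ℕ) (p : ℝ) (f : Vec n → Vec n) : ℝ≥0∞ :=
  (⨆ r ∈ Set.Ioo (0 : ℝ) 1, hardyMean n p f r) ^ (1 / p)

/-- `f` belongs to the Hardy space `H^p`. -/
def MemHp (n : ℕ) (p : ℝ) (f : Vec n → Vec n) : Prop := hardyNorm n p f < ⊤

/-- The `L^p(σ)` norm of a boundary function on the unit sphere. -/
def lpSphere (n : ℕ) (p : ℝ) (g : Vec n → Vec n) : ℝ≥0∞ :=
  (∫⁻ ω, ENNReal.ofReal (‖g ω‖ ^ p) ∂(sphMeasure n)) ^ (1 / p)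

/-- The `L^p(σ)` norm of the non-tangential maximal function `f*`. -/
def ntMaxLp (n : ℕ) (κ p : ℝ) (f : Vec n → Vec n) : ℝ≥0∞ :=
  (∫⁻ ω, (ntMax n κ f ω) ^ p ∂(sphMeasure n)) ^ (1 / p)

/-- `μ` is a Carleson measure on the unit ball with constant `c`. -/
def IsCarleson (n : ℕ) (c : ℝ) (μ : Measure (Vec n)) : Prop :=
  ∀ ω ∈ unitSphere n, ∀ r : ℝ, 0 < r →
    μ (unitBall n ∩ Metric.ball ω r) ≤ ENNReal.ofReal c * ENNReal.ofReal r ^ ((n : ℝ) - 1)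

/-- `μ` is an `α`-Carleson measure on the unit ball with constant `γ`. -/
def IsAlphaCarleson (n : ℕ) (α γ : ℝ) (μ : Measure (Vec n)) : Prop :=
  ∀ ω ∈ unitSphere n, ∀ r : ℝ, 0 < r →
    μ (unitBall n ∩ Metric.ball ω r) ≤
      ENNReal.ofReal γ * ENNReal.ofReal r ^ (α * ((n : ℝ) - 1))

/-! ### The area inequality with multiplicity -/

theorem lintegral_abs_det_fderiv_mul_le {E : Type*} [NormedAddCommGroup E] [NormedSpace ℝ E]
    [FiniteDimensional ℝ E] [MeasurableSpace E] [BorelSpace E] (μ : Measure E)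
    [μ.IsAddHaarMeasure] {f : E → E} {s R : Set E} (hs : MeasurableSet s)
    (hf : ∀ x ∈ s, DifferentiableAt ℝ f x) (hR : MapsTo f s R) {N : ℝ≥0∞}
    (hN : ∀ y, (({z ∈ s | f z = y}).encard : ℝ≥0∞) ≤ N) {g : E → ℝ≥0∞} (hg : Measurable g) :
    ∫⁻ x in s, ENNReal.ofReal |(fderiv ℝ f x).det| * g (f x) ∂μ ≤ N * ∫⁻ y in R, g y ∂μ := by
  have hdet : Measurable fun x => (fderiv ℝ f x).det :=
    ContinuousLinearMap.continuous_det.measurable.comp (measurable_fderiv ℝ f)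
  set s' := s ∩ {x | (fderiv ℝ f x).det ≠ 0} with hs'def
  have hs' : MeasurableSet s' :=
    hs.inter (hdet (measurableSet_singleton (0 : ℝ)).compl)
  have hred : ∫⁻ x in s, ENNReal.ofReal |(fderiv ℝ f x).det| * g (f x) ∂μ
      = ∫⁻ x in s', ENNReal.ofReal |(fderiv ℝ f x).det| * g (f x) ∂μ := by
    rw [← lintegral_indicator hs, ← lintegral_indicator hs']
    refine lintegral_congr fun x => ?_
    by_cases hx : x ∈ s <;> by_cases hd : (fderiv ℝ f x).det = 0 <;> simp [s', hx, hd]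
  rw [hred]
  rcases s'.eq_empty_or_nonempty with hemp | hne
  · simp [hemp]
  have hder : ∀ x ∈ s', HasFDerivWithinAt f (fderiv ℝ f x) s' x :=
    fun x hx => (hf x hx.1).hasFDerivAt.hasFDerivWithinAt
  have hrad : ∀ A : E →L[ℝ] E, ∃ r : ℝ≥0, r ≠ 0 ∧ ∀ t : Set E, A.det ≠ 0 →
      ApproximatesLinearOn f A t r → InjOn f t := by
    intro A
    by_cases hA : A.det = 0
    · exact ⟨1, one_ne_zero, fun t h => absurd hA h⟩
    · set B := A.toContinuousLinearEquivOfDetNeZero hA with hB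
      by_cases hsub : Subsingleton E
      · exact ⟨1, one_ne_zero, fun t _ _ => fun x _ y _ _ => Subsingleton.elim _ _⟩
      · rw [not_subsingleton_iff_nontrivial] at hsub
        have hpos : 0 < ‖(B.symm : E →L[ℝ] E)‖₊⁻¹ := by
          rw [inv_pos]
          exact B.symm.norm_pos
        refine ⟨‖(B.symm : E →L[ℝ] E)‖₊⁻¹ / 2, (half_pos hpos).ne', fun t _ ht => ?_⟩
        have ht' : ApproximatesLinearOn f (B : E →L[ℝ] E) t (‖(B.symm : E →L[ℝ] E)‖₊⁻¹ / 2) := by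
          simpa [hB] using ht
        exact ht'.injOn (Or.inr (half_lt_self hpos))
  choose r hr0 hr using hrad
  obtain ⟨t, A, htd, htm, hcov, happ, hA⟩ :=
    exists_partition_approximatesLinearOn_of_hasFDerivWithinAt f s' (fderiv ℝ f) hder r hr0
  have hinj : ∀ i, InjOn f (s' ∩ t i) := fun i => by
    obtain ⟨y, hy, hAy⟩ := hA hne i
    exact hr (A i) _ (hAy ▸ hy.2) (happ i)
  have hsm : ∀ i, MeasurableSet (s' ∩ t i) := fun i => hs'.inter (htm i)
  have him : ∀ i, MeasurableSet (f '' (s' ∩ t i)) := fun i =>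
    measurable_image_of_fderivWithin (hsm i)
      (fun x hx => (hder x hx.1).mono inter_subset_left) (hinj i)
  have hU : s' = ⋃ i, s' ∩ t i := by rw [← inter_iUnion, inter_eq_left.2 hcov]
  calc ∫⁻ x in s', ENNReal.ofReal |(fderiv ℝ f x).det| * g (f x) ∂μ
      = ∑' i, ∫⁻ x in s' ∩ t i, ENNReal.ofReal |(fderiv ℝ f x).det| * g (f x) ∂μ := by
        conv_lhs => rw [hU]
        exact lintegral_iUnion hsm
          (fun i j hij => (htd hij).mono inter_subset_right inter_subset_right) _
    _ = ∑' i, ∫⁻ y in f '' (s' ∩ t i), g y ∂μ := by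
        refine tsum_congr fun i => ?_
        exact (lintegral_image_eq_lintegral_abs_det_fderiv_mul μ (hsm i)
          (fun x hx => (hder x hx.1).mono inter_subset_left) (hinj i) g).symm
    _ = ∑' i, ∫⁻ y in R, (f '' (s' ∩ t i)).indicator g y ∂μ := by
        refine tsum_congr fun i => ?_
        have hsub : f '' (s' ∩ t i) ⊆ R := by
          rintro _ ⟨x, hx, rfl⟩
          exact hR hx.1.1
        rw [setLIntegral_indicator (him i), inter_eq_left.2 hsub]
    _ = ∫⁻ y in R, ∑' i, (f '' (s' ∩ t i)).indicator g y ∂μ :=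
        (lintegral_tsum fun i => (hg.indicator (him i)).aemeasurable).symm
    _ ≤ ∫⁻ y in R, N * g y ∂μ := by
        refine lintegral_mono fun y => ?_
        have hind : ∀ i, (f '' (s' ∩ t i)).indicator g y
            = (f '' (s' ∩ t i)).indicator 1 y * g y := fun i => by
          by_cases h : y ∈ f '' (s' ∩ t i) <;> simp [h]
        simp_rw [hind, ENNReal.tsum_mul_right]
        gcongr
        refine le_trans ?_ (hN y)
        have : ∀ i, (f '' (s' ∩ t i)).indicator (1 : E → ℝ≥0∞) y
            = {i | y ∈ f '' (s' ∩ t i)}.indicator (fun _ => (1 : ℝ≥0∞)) i := fun i => by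
          by_cases h : y ∈ f '' (s' ∩ t i)
          · rw [indicator_of_mem h, indicator_of_mem (show i ∈ {i | y ∈ f '' (s' ∩ t i)} from h)]
            rfl
          · rw [indicator_of_notMem h,
              indicator_of_notMem (show i ∉ {i | y ∈ f '' (s' ∩ t i)} from h)]
        simp_rw [this]
        rw [← tsum_subtype, ENNReal.tsum_const, mul_one]
        change ((Set.encard {i | y ∈ f '' (s' ∩ t i)} : ℕ∞) : ℝ≥0∞) ≤ _
        have hch : ∀ i : ℕ, ∃ x, y ∈ f '' (s' ∩ t i) → x ∈ s' ∩ t i ∧ f x = y := fun i => by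
          by_cases h : y ∈ f '' (s' ∩ t i)
          · obtain ⟨x, hx, hxy⟩ := h
            exact ⟨x, fun _ => ⟨hx, hxy⟩⟩
          · exact ⟨hne.some, fun h' => absurd h' h⟩
        choose c hc using hch
        refine ENat.toENNReal_le.2 (Set.encard_le_encard_of_injOn (f := c) ?_ ?_)
        · intro i hi
          exact ⟨(hc i hi).1.1.1, (hc i hi).2⟩
        · intro i hi j hj hij
          by_contra hne'
          exact (Set.disjoint_left.1 (htd hne') (hc i hi).1.2) (hij ▸ (hc j hj).1.2)
    _ = N * ∫⁻ y in R, g y ∂μ := lintegral_const_mul _ hg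

/-! ### Möbius-free consequences of the hypotheses -/

/-- The quantity `|x|² |z - x/|x|²|²`, extended to `x = 0`. -/
def mobiusDen {n : ℕ} (x z : Vec n) : ℝ :=
  ‖z - x‖ ^ 2 + (1 - ‖x‖ ^ 2) * (1 - ‖z‖ ^ 2)

theorem mobiusDen_comm {n : ℕ} (x z : Vec n) : mobiusDen x z = mobiusDen z x := by
  unfold mobiusDen
  rw [norm_sub_rev]; ring

theorem mobiusDen_pos {n : ℕ} {x z : Vec n} (hx : ‖x‖ < 1) (hz : ‖z‖ < 1) :
    0 < mobiusDen x z := by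
  unfold mobiusDen
  have h1 : 0 < 1 - ‖x‖ ^ 2 := by nlinarith [norm_nonneg x]
  have h2 : 0 < 1 - ‖z‖ ^ 2 := by nlinarith [norm_nonneg z]
  positivity

theorem mobiusT_eq {n : ℕ} (x z : Vec n) :
    mobiusT n x z = (mobiusDen x z)⁻¹ • ((1 - ‖x‖ ^ 2) • (z - x) - ‖z - x‖ ^ 2 • x) := by
  unfold mobiusT
  split_ifs with h
  · subst h
    simp only [mobiusDen, sub_zero, norm_zero]
    norm_num
  · congr 2
    have hx : ‖x‖ ^ 2 ≠ 0 := by simpa using h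
    rw [mobiusDen, norm_sub_sq_real, norm_sub_sq_real, inner_smul_right, norm_smul, norm_inv,
      norm_pow, norm_norm]
    field_simp
    ring

theorem norm_mobiusT_sq {n : ℕ} {x z : Vec n} (hx : ‖x‖ < 1) (hz : ‖z‖ < 1) :
    ‖mobiusT n x z‖ ^ 2 = ‖z - x‖ ^ 2 / mobiusDen x z := by
  have hD := (mobiusDen_pos hx hz).ne'
  rw [mobiusT_eq, norm_smul, mul_pow, norm_inv, inv_pow, Real.norm_eq_abs, sq_abs,
    norm_sub_sq_real, norm_smul, norm_smul, inner_smul_left, inner_smul_right, inner_sub_left,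
    real_inner_self_eq_norm_sq, norm_pow, norm_norm, mul_pow, Real.norm_eq_abs, sq_abs]
  simp only [conj_trivial]
  have hD' : mobiusDen x z = 1 - 2 * inner ℝ z x + ‖x‖ ^ 2 * ‖z‖ ^ 2 := by
    rw [mobiusDen, norm_sub_sq_real]; ring
  rw [hD'] at hD ⊢
  field_simp
  rw [norm_sub_sq_real]
  ring

theorem mobiusT_neg_mobiusT {n : ℕ} {x z : Vec n} (hx : ‖x‖ < 1) (hz : ‖z‖ < 1) :
    mobiusT n (-x) (mobiusT n x z) = z := by
  have hD := (mobiusDen_pos hx hz).ne'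
  have hD' : mobiusDen x z = 1 - 2 * inner ℝ z x + ‖x‖ ^ 2 * ‖z‖ ^ 2 := by
    rw [mobiusDen, norm_sub_sq_real]; ring
  have hb : 1 - ‖x‖ ^ 2 ≠ 0 := by nlinarith [norm_nonneg x]
  have hy : mobiusT n x z + x
      = ((1 - ‖x‖ ^ 2) / mobiusDen x z) • (z - ‖z‖ ^ 2 • x) := by
    rw [mobiusT_eq]
    have : ∀ v : Vec n, (mobiusDen x z)⁻¹ • v + x
        = (mobiusDen x z)⁻¹ • (v + mobiusDen x z • x) := fun v => by
      rw [smul_add, inv_smul_smul₀ hD]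
    rw [this, div_eq_inv_mul, mul_smul]
    congr 1
    rw [mobiusDen]
    module
  have hyn : ‖mobiusT n x z + x‖ ^ 2 = (1 - ‖x‖ ^ 2) ^ 2 * ‖z‖ ^ 2 / mobiusDen x z := by
    rw [hy, norm_smul, mul_pow, Real.norm_eq_abs, sq_abs, norm_sub_sq_real, norm_smul,
      inner_smul_right, norm_pow, norm_norm]
    rw [hD'] at hD ⊢
    field_simp
  have hden : mobiusDen (-x) (mobiusT n x z) = (1 - ‖x‖ ^ 2) ^ 2 / mobiusDen x z := by
    rw [mobiusDen, sub_neg_eq_add, hyn, norm_neg, norm_mobiusT_sq hx hz]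
    rw [norm_sub_sq_real]
    rw [hD'] at hD ⊢
    field_simp
    ring
  rw [mobiusT_eq, hden, sub_neg_eq_add, hyn, hy, norm_neg, smul_neg, sub_neg_eq_add, smul_smul,
    mul_comm ((1 - ‖x‖ ^ 2)), ← mul_div_right_comm]
  rw [show (1 - ‖x‖ ^ 2) ^ 2 * ‖z‖ ^ 2 / mobiusDen x z
    = ((1 - ‖x‖ ^ 2) ^ 2 / mobiusDen x z) * ‖z‖ ^ 2 by ring,
    show (1 - ‖x‖ ^ 2) * (1 - ‖x‖ ^ 2) / mobiusDen x z = (1 - ‖x‖ ^ 2) ^ 2 / mobiusDen x z by ring,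
    mul_smul, ← smul_add, inv_smul_smul₀ (by positivity)]
  module

theorem mobiusT_neg_zero {n : ℕ} (x : Vec n) : mobiusT n (-x) 0 = x := by
  rw [mobiusT_eq]
  simp only [mobiusDen, norm_neg, norm_zero, zero_sub, neg_neg]
  norm_num
  rw [← add_smul]
  simp

/-- If `t D(x, z) ≤ (1-|x|²)(1-|z|²)` then `T_x z` stays at distance `t / 2` from the sphere. -/
theorem norm_mobiusT_le {n : ℕ} {x z : Vec n} (hx : ‖x‖ < 1) (hz : ‖z‖ < 1) {t : ℝ} (ht : 0 < t)
    (h : t * mobiusDen x z ≤ (1 - ‖x‖ ^ 2) * (1 - ‖z‖ ^ 2)) :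
    ‖mobiusT n x z‖ < 1 ∧ t ≤ 1 - ‖mobiusT n x z‖ ^ 2 ∧ t / 2 ≤ 1 - ‖mobiusT n x z‖ := by
  have hD := mobiusDen_pos hx hz
  have h1 : t ≤ 1 - ‖mobiusT n x z‖ ^ 2 := by
    rw [norm_mobiusT_sq hx hz, le_sub_comm, div_le_iff₀ hD]
    have : mobiusDen x z = ‖z - x‖ ^ 2 + (1 - ‖x‖ ^ 2) * (1 - ‖z‖ ^ 2) := rfl
    linarith
  have h0 := norm_nonneg (mobiusT n x z)
  have h2 : ‖mobiusT n x z‖ < 1 := by nlinarith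
  exact ⟨h2, h1, by nlinarith⟩

theorem InMiniowitz.norm_le {n : ℕ} {C₀ α : ℝ} {f : Vec n → Vec n} (hC₀ : 0 ≤ C₀) (hα : 0 ≤ α)
    (hf : InMiniowitz n C₀ α f) (hf0 : ∀ x ∈ unitBall n, f x ≠ 0) {x z : Vec n} (hx : ‖x‖ < 1)
    (hz : ‖z‖ < 1) {t : ℝ} (ht : 0 < t)
    (h : t * mobiusDen x z ≤ (1 - ‖x‖ ^ 2) * (1 - ‖z‖ ^ 2)) :
    ‖f z‖ ≤ C₀ * (4 / t) ^ α * ‖f x‖ := by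
  obtain ⟨h1, h2, h3⟩ := norm_mobiusT_le hx hz ht h
  have := (hf x (by simpa [unitBall] using hx) (mobiusT n x z) (by simpa [unitBall] using h1)).2
  rw [mobiusT_neg_mobiusT hx hz, mobiusT_neg_zero, div_le_iff₀ (by
    simpa using hf0 x (by simpa [unitBall] using hx))] at this
  refine this.trans ?_
  have h0 := norm_nonneg (mobiusT n x z)
  have h4 : 0 < 1 - ‖mobiusT n x z‖ := by linarith
  have h5 : (1 + ‖mobiusT n x z‖) / (1 - ‖mobiusT n x z‖) ≤ 4 / t := by
    rw [div_le_div_iff₀ h4 ht]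
    nlinarith
  gcongr

theorem MultCond.encard_le {n : ℕ} {a C₁ : ℝ} {f : Vec n → Vec n}
    (hf : MultCond n a C₁ f) {x : Vec n} (hx : ‖x‖ < 1) {t : ℝ} (ht : 0 < t) (ht1 : t ≤ 1)
    {s : Set (Vec n)} (hs : ∀ z ∈ s, ‖z‖ < 1 ∧
      t * mobiusDen x z ≤ (1 - ‖x‖ ^ 2) * (1 - ‖z‖ ^ 2)) (y : Vec n) :
    (({z ∈ s | f z = y}).encard : ℝ≥0∞) ≤ ENNReal.ofReal (C₁ / (t / 4) ^ a) := by
  have := hf x (by simpa [unitBall] using hx) (1 - t / 4) (by linarith) (by linarith) y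
  rw [sub_sub_cancel] at this
  refine le_trans (ENat.toENNReal_le.2 ?_) this
  refine Set.encard_le_encard_of_injOn (f := mobiusT n x) ?_ ?_
  · intro z hz
    obtain ⟨hz1, hz2⟩ := hs z hz.1
    have h3 := (norm_mobiusT_le hx hz1 ht hz2).2.2
    refine ⟨?_, ?_⟩
    · simp only [mem_ball, dist_zero_right]; linarith
    · rw [mobiusT_neg_mobiusT hx hz1]; exact hz.2
  · intro z hz w hw hzw
    rw [← mobiusT_neg_mobiusT hx (hs z hz.1).1, hzw, mobiusT_neg_mobiusT hx (hs w hw.1).1]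

/-! ### Polar coordinates -/

/-- The cone measure on the unit sphere, as a measure on the ambient space. -/
def coneMeasure (n : ℕ) : Measure (Vec n) :=
  ((volume : Measure (Vec n)).toSphere).map Subtype.val

instance (n : ℕ) : IsFiniteMeasure (coneMeasure n) := by
  unfold coneMeasure; infer_instance

theorem ae_norm_eq_one_coneMeasure (n : ℕ) : ∀ᵐ ω ∂coneMeasure n, ‖ω‖ = 1 := by
  rw [coneMeasure, ae_map_iff measurable_subtype_coe.aemeasurable
    (measurableSet_eq_fun measurable_norm measurable_const)]
  exact Filter.Eventually.of_forall fun x => norm_eq_of_mem_sphere x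

theorem nontrivial_vec {n : ℕ} (hn : 1 ≤ n) : Nontrivial (Vec n) := by
  have : Nonempty (Fin n) := ⟨⟨0, hn⟩⟩
  infer_instance

theorem lintegral_polar {n : ℕ} (hn : 1 ≤ n) {h : Vec n → ℝ≥0∞} (hh : Measurable h) :
    ∫⁻ x, h x = ∫⁻ ω, (∫⁻ s in Ioi (0 : ℝ), ENNReal.ofReal (s ^ (n - 1)) * h (s • ω))
      ∂coneMeasure n := by
  have := nontrivial_vec hn
  have hm := (volume : Measure (Vec n)).measurePreserving_homeomorphUnitSphereProd
  have hmeas : Measurable fun q : sphere (0 : Vec n) 1 × Ioi (0 : ℝ) =>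
      h (q.2.1 • q.1.1) := by fun_prop
  have h1 : ∫⁻ x, h x = ∫⁻ x : ({(0)}ᶜ : Set (Vec n)), h x.1 ∂((volume : Measure (Vec n)).comap Subtype.val) := by
    rw [lintegral_subtype_comap (measurableSet_singleton _).compl, restrict_compl_singleton]
  have h2 : ∀ x : ({(0)}ᶜ : Set (Vec n)), h x.1
      = (fun q : sphere (0 : Vec n) 1 × Ioi (0 : ℝ) => h (q.2.1 • q.1.1))
        (homeomorphUnitSphereProd (Vec n) x) := fun x => by
    have : ‖x.1‖ ≠ 0 := norm_ne_zero_iff.2 x.2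
    simp [smul_smul, this]
  simp_rw [h1, h2]
  rw [hm.lintegral_comp hmeas, lintegral_prod _ hmeas.aemeasurable, coneMeasure, lintegral_map]
  · refine lintegral_congr fun ω => ?_
    rw [Measure.volumeIoiPow, lintegral_withDensity_eq_lintegral_mul₀ (by fun_prop)
      (by fun_prop), ← lintegral_subtype_comap measurableSet_Ioi]
    simp
  · exact Measurable.lintegral_prod_right' (f := fun q : Vec n × ℝ =>
      ENNReal.ofReal (q.2 ^ (n - 1)) * h (q.2 • q.1)) (by fun_prop)
  · exact measurable_subtype_coe

theorem coneMeasure_univ_ne_zero {n : ℕ} (hn : 1 ≤ n) : coneMeasure n univ ≠ 0 := by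
  rw [coneMeasure, Measure.map_apply measurable_subtype_coe MeasurableSet.univ, preimage_univ,
    Measure.toSphere_apply_univ]
  simp only [finrank_euclideanSpace, Fintype.card_fin]
  exact mul_ne_zero (by simpa using by omega) (measure_ball_pos _ _ one_pos).ne'

theorem measurableSet_sector {n : ℕ} {A : Set (Vec n)} (hA : MeasurableSet A) {I : Set ℝ}
    (hI : MeasurableSet I) : MeasurableSet {x : Vec n | ‖x‖ ∈ I ∧ ‖x‖⁻¹ • x ∈ A} :=
  (measurable_norm hI).inter ((by fun_prop : Measurable fun x : Vec n => ‖x‖⁻¹ • x) hA)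

/-- Lebesgue measure of a sector of a spherical shell. -/
theorem volume_sector {n : ℕ} (hn : 1 ≤ n) {A : Set (Vec n)} (hA : MeasurableSet A) {I : Set ℝ}
    (hI : MeasurableSet I) :
    volume {x : Vec n | ‖x‖ ∈ I ∧ ‖x‖⁻¹ • x ∈ A}
      = (∫⁻ s in I ∩ Ioi (0 : ℝ), ENNReal.ofReal (s ^ (n - 1))) * coneMeasure n A := by
  have hS := measurableSet_sector hA hI
  rw [← lintegral_indicator_one hS, lintegral_polar hn (measurable_one.indicator hS),
    ← lintegral_indicator_one hA, ← lintegral_const_mul _ (measurable_one.indicator hA)]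
  refine lintegral_congr_ae ?_
  filter_upwards [ae_norm_eq_one_coneMeasure n] with ω hω
  rw [← Measure.restrict_restrict hI, ← lintegral_indicator hI,
    ← lintegral_mul_const' _ _ (by by_cases h : ω ∈ A <;> simp [h])]
  refine setLIntegral_congr_fun measurableSet_Ioi fun s hs => ?_
  have hs' : (0 : ℝ) < s := hs
  by_cases h1 : s ∈ I <;> by_cases h2 : ω ∈ A <;>
    simp [indicator, norm_smul, hω, abs_of_pos hs', smul_smul, hs'.ne', h1, h2]

theorem coneMeasure_ball_eq {n : ℕ} (hn : 1 ≤ n) {ω η : Vec n} (hω : ‖ω‖ = 1) (hη : ‖η‖ = 1)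
    (ε : ℝ) : coneMeasure n (ball ω ε) = coneMeasure n (ball η ε) := by
  have key : ∀ v : Vec n, volume {x : Vec n | ‖x‖ ∈ Ioc (0 : ℝ) 1 ∧ ‖x‖⁻¹ • x ∈ ball v ε}
      = (∫⁻ s in Ioc (0 : ℝ) 1, ENNReal.ofReal (s ^ (n - 1))) * coneMeasure n (ball v ε) := by
    intro v
    rw [volume_sector hn measurableSet_ball measurableSet_Ioc, inter_eq_left.2]
    exact fun s hs => hs.1
  have hc : (∫⁻ s in Ioc (0 : ℝ) 1, ENNReal.ofReal (s ^ (n - 1))) = ENNReal.ofReal (1 / n) := by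
    rw [← ofReal_integral_eq_lintegral_ofReal (intervalIntegral.intervalIntegrable_pow _).1,
      ← intervalIntegral.integral_of_le zero_le_one, integral_pow]
    · have : ((n - 1 : ℕ) : ℝ) + 1 = n := by exact_mod_cast Nat.sub_add_cancel hn
      rw [this, Nat.sub_add_cancel hn, zero_pow (by omega)]
      simp
    · filter_upwards [ae_restrict_mem measurableSet_Ioc] with s hs using pow_nonneg hs.1.le _
  have hinv : volume {x : Vec n | ‖x‖ ∈ Ioc (0 : ℝ) 1 ∧ ‖x‖⁻¹ • x ∈ ball ω ε}
      = volume {x : Vec n | ‖x‖ ∈ Ioc (0 : ℝ) 1 ∧ ‖x‖⁻¹ • x ∈ ball η ε} := by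
    obtain ⟨L, hL⟩ : ∃ L : Vec n ≃ₗᵢ[ℝ] Vec n, L ω = η :=
      ⟨_, Submodule.reflection_sub (hω.trans hη.symm)⟩
    have hS := measurableSet_sector (measurableSet_ball : MeasurableSet (ball η ε))
      (measurableSet_Ioc : MeasurableSet (Ioc (0 : ℝ) 1))
    rw [← (LinearIsometryEquiv.measurePreserving L).measure_preimage hS.nullMeasurableSet]
    congr 1
    ext x
    have : dist (‖x‖⁻¹ • L x) η = dist (‖x‖⁻¹ • x) ω := by
      rw [← hL, ← map_smul, L.dist_map]
    simp [this]
  rw [key, key, hc] at hinv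
  refine (ENNReal.mul_right_inj ?_ ENNReal.ofReal_ne_top).1 hinv
  simpa using by omega

theorem norm_inv_smul_sub_eq {n : ℕ} {x : Vec n} (hx : x ≠ 0) :
    ‖‖x‖⁻¹ • x - x‖ = |1 - ‖x‖| := by
  have h0 : ‖x‖ ≠ 0 := by simpa using hx
  have : ‖x‖⁻¹ • x - x = (‖x‖⁻¹ - 1) • x := by module
  rw [this, norm_smul, Real.norm_eq_abs]
  nth_rewrite 2 [← abs_of_nonneg (norm_nonneg x)]
  rw [← abs_mul]
  congr 1
  field_simp

theorem coneMeasure_ball_le {n : ℕ} (hn : 1 ≤ n) {ω : Vec n} (hω : ‖ω‖ = 1) {ρ : ℝ}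
    (hρ : 0 < ρ) :
    coneMeasure n (ball ω ρ) ≤
      ENNReal.ofReal (2 ^ n * ρ ^ (n - 1)) * volume (ball (0 : Vec n) 1) := by
  have h1 := volume_sector hn (measurableSet_ball : MeasurableSet (ball ω ρ))
    (measurableSet_Ioo : MeasurableSet (Ioo (1 : ℝ) (1 + ρ)))
  have h2 : volume {x : Vec n | ‖x‖ ∈ Ioo (1 : ℝ) (1 + ρ) ∧ ‖x‖⁻¹ • x ∈ ball ω ρ}
      ≤ ENNReal.ofReal ((2 * ρ) ^ n) * volume (ball (0 : Vec n) 1) := by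
    have := nontrivial_vec hn
    have := (volume : Measure (Vec n)).addHaar_ball ω (r := 2 * ρ) (by positivity)
    rw [finrank_euclideanSpace, Fintype.card_fin] at this
    rw [← this]
    refine measure_mono fun x hx => ?_
    have hx0 : x ≠ 0 := by
      rintro rfl
      have := hx.1.1
      simp at this
      linarith
    have h3 := norm_inv_smul_sub_eq hx0
    have h4 : ‖x - ‖x‖⁻¹ • x‖ < ρ := by
      rw [norm_sub_rev, h3, abs_sub_comm, abs_of_nonneg] <;> linarith [hx.1.1, hx.1.2]
    have h5 : dist (‖x‖⁻¹ • x) ω < ρ := hx.2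
    have h6 := dist_triangle x (‖x‖⁻¹ • x) ω
    rw [mem_ball]
    rw [dist_eq_norm x (‖x‖⁻¹ • x)] at h6
    linarith
  have h3 : ENNReal.ofReal ρ ≤ ∫⁻ s in Ioo (1 : ℝ) (1 + ρ) ∩ Ioi (0 : ℝ),
      ENNReal.ofReal (s ^ (n - 1)) := by
    have hsub : Ioo (1 : ℝ) (1 + ρ) ⊆ Ioi 0 := fun s hs => zero_lt_one.trans hs.1
    rw [inter_eq_left.2 hsub]
    calc ENNReal.ofReal ρ = ∫⁻ s in Ioo (1 : ℝ) (1 + ρ), 1 := by simp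
      _ ≤ _ := by
        refine setLIntegral_mono (by fun_prop) fun s hs => ?_
        rw [← ENNReal.ofReal_one]
        exact ENNReal.ofReal_le_ofReal (one_le_pow₀ hs.1.le)
  have h4 : ENNReal.ofReal ρ * coneMeasure n (ball ω ρ)
      ≤ ENNReal.ofReal ρ * (ENNReal.ofReal (2 ^ n * ρ ^ (n - 1)) * volume (ball (0 : Vec n) 1)) := by
    calc _ ≤ _ := mul_le_mul_left h3 _
      _ ≤ _ := h1 ▸ h2
      _ = _ := by
        rw [← mul_assoc, ← ENNReal.ofReal_mul hρ.le]
        congr 2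
        obtain ⟨m, rfl⟩ := Nat.exists_eq_add_of_le' hn
        simp only [Nat.add_sub_cancel]
        ring
  exact (ENNReal.mul_le_mul_iff_right (by simpa using hρ) ENNReal.ofReal_ne_top).1 h4

theorem le_coneMeasure_ball {n : ℕ} (hn : 1 ≤ n) {ω : Vec n} (hω : ‖ω‖ = 1) {ρ : ℝ}
    (hρ : 0 < ρ) (hρ1 : ρ ≤ 1) :
    ENNReal.ofReal (ρ ^ (n - 1)) * volume (ball (0 : Vec n) 1) ≤
      ENNReal.ofReal (4 ^ n) * coneMeasure n (ball ω ρ) := by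
  have h1 := volume_sector hn (measurableSet_ball : MeasurableSet (ball ω ρ))
    (measurableSet_Ioo : MeasurableSet (Ioo (1 - ρ / 2) (1 + ρ / 2)))
  have h2 : ENNReal.ofReal ((ρ / 2) ^ n) * volume (ball (0 : Vec n) 1) ≤
      volume {x : Vec n | ‖x‖ ∈ Ioo (1 - ρ / 2) (1 + ρ / 2) ∧ ‖x‖⁻¹ • x ∈ ball ω ρ} := by
    have := nontrivial_vec hn
    have := (volume : Measure (Vec n)).addHaar_ball ω (r := ρ / 2) (by positivity)
    rw [finrank_euclideanSpace, Fintype.card_fin] at this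
    rw [← this]
    refine measure_mono fun x hx => ?_
    rw [mem_ball, dist_eq_norm] at hx
    have h0 := abs_le.1 (abs_norm_sub_norm_le x ω)
    rw [hω] at h0
    have hx0 : x ≠ 0 := by
      rintro rfl
      rw [zero_sub, norm_neg, hω] at hx
      linarith
    refine ⟨⟨by linarith, by linarith⟩, ?_⟩
    have h3 := norm_inv_smul_sub_eq hx0
    have h4 : |1 - ‖x‖| < ρ / 2 := abs_lt.2 ⟨by linarith, by linarith⟩
    have h6 := norm_sub_le_norm_sub_add_norm_sub (‖x‖⁻¹ • x) x ω
    rw [mem_ball, dist_eq_norm]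
    linarith
  have h3 : ∫⁻ s in Ioo (1 - ρ / 2) (1 + ρ / 2) ∩ Ioi (0 : ℝ), ENNReal.ofReal (s ^ (n - 1))
      ≤ ENNReal.ofReal (2 ^ (n - 1) * ρ) := by
    calc _ ≤ ∫⁻ s in Ioo (1 - ρ / 2) (1 + ρ / 2), ENNReal.ofReal (s ^ (n - 1)) :=
          lintegral_mono_set inter_subset_left
      _ ≤ ∫⁻ s in Ioo (1 - ρ / 2) (1 + ρ / 2), ENNReal.ofReal (2 ^ (n - 1)) := by
        refine setLIntegral_mono (by fun_prop) fun s hs => ?_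
        exact ENNReal.ofReal_le_ofReal
          (pow_le_pow_left₀ (by linarith [hs.1]) (by linarith [hs.2]) _)
      _ = _ := by
        rw [setLIntegral_const, Real.volume_Ioo, ← ENNReal.ofReal_mul (by positivity)]
        congr 2; ring
  have h4 : ENNReal.ofReal (ρ / 2 ^ n) *
        (ENNReal.ofReal (ρ ^ (n - 1)) * volume (ball (0 : Vec n) 1))
      ≤ ENNReal.ofReal (ρ / 2 ^ n) * (ENNReal.ofReal (4 ^ n) * coneMeasure n (ball ω ρ)) := by
    calc _ = ENNReal.ofReal ((ρ / 2) ^ n) * volume (ball (0 : Vec n) 1) := by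
          rw [← mul_assoc, ← ENNReal.ofReal_mul (by positivity)]
          congr 2
          obtain ⟨m, rfl⟩ := Nat.exists_eq_add_of_le' hn
          simp only [Nat.add_sub_cancel]
          rw [div_pow]; ring
      _ ≤ _ := h2.trans_eq h1
      _ ≤ _ := mul_le_mul_left h3 _
      _ ≤ ENNReal.ofReal (ρ / 2 ^ n * 4 ^ n) * coneMeasure n (ball ω ρ) := by
          have h5 : ρ / 2 ^ n * 4 ^ n = 2 ^ n * ρ := by
            rw [show (4 : ℝ) = 2 * 2 by norm_num, mul_pow]
            field_simp
          rw [h5]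
          gcongr
          · norm_num
          · omega
      _ = _ := by rw [← mul_assoc, ← ENNReal.ofReal_mul (by positivity)]
  exact (ENNReal.mul_le_mul_iff_right (by simpa using by positivity) ENNReal.ofReal_ne_top).1 h4

theorem lintegral_annulus_inv_norm_pow {n : ℕ} (hn : 1 ≤ n) {a b : ℝ} (ha : 0 < a) (hab : a ≤ b) :
    ∫⁻ y in {y : Vec n | ‖y‖ ∈ Icc a b}, (ENNReal.ofReal (‖y‖ ^ n))⁻¹
      = ENNReal.ofReal (Real.log (b / a)) * coneMeasure n univ := by
  have hS : MeasurableSet {y : Vec n | ‖y‖ ∈ Icc a b} := measurable_norm measurableSet_Icc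
  rw [← lintegral_indicator hS, lintegral_polar hn ((by fun_prop : Measurable fun y : Vec n =>
    (ENNReal.ofReal (‖y‖ ^ n))⁻¹).indicator hS)]
  rw [← lintegral_const]
  refine lintegral_congr_ae ?_
  filter_upwards [ae_norm_eq_one_coneMeasure n] with ω hω
  have h1 : ∀ s ∈ Ioi (0 : ℝ), ENNReal.ofReal (s ^ (n - 1)) *
      ({y : Vec n | ‖y‖ ∈ Icc a b}.indicator (fun y => (ENNReal.ofReal (‖y‖ ^ n))⁻¹) (s • ω))
      = (Icc a b).indicator (fun s => ENNReal.ofReal s⁻¹) s := by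
    intro s hs
    have hs' : (0 : ℝ) < s := hs
    by_cases h : s ∈ Icc a b
    · have h' : s • ω ∈ {y : Vec n | ‖y‖ ∈ Icc a b} := by
        simpa [norm_smul, hω, abs_of_pos hs'] using h
      rw [indicator_of_mem h, indicator_of_mem h', norm_smul, hω, mul_one, Real.norm_eq_abs,
        abs_of_pos hs', ← ENNReal.ofReal_inv_of_pos (by positivity),
        ← ENNReal.ofReal_mul (by positivity)]
      congr 1
      obtain ⟨m, rfl⟩ := Nat.exists_eq_add_of_le' hn
      simp only [Nat.add_sub_cancel]
      field_simp
      ring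
    · have h' : s • ω ∉ {y : Vec n | ‖y‖ ∈ Icc a b} := by
        simpa [norm_smul, hω, abs_of_pos hs'] using h
      rw [indicator_of_notMem h, indicator_of_notMem h', mul_zero]
  have hsub : Icc a b ⊆ Ioi 0 := fun s hs => ha.trans_le hs.1
  rw [setLIntegral_congr_fun measurableSet_Ioi h1, lintegral_indicator measurableSet_Icc,
    Measure.restrict_restrict measurableSet_Icc, inter_eq_left.2 hsub,
    Measure.restrict_congr_set Ioc_ae_eq_Icc.symm, ← ofReal_integral_eq_lintegral_ofReal,
    ← intervalIntegral.integral_of_le hab, integral_inv_of_pos ha (ha.trans_le hab)]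
  · refine (intervalIntegral.intervalIntegrable_inv (fun x hx => ?_) continuousOn_id).1
    rw [uIcc_of_le hab] at hx
    exact (ha.trans_le hx.1).ne'
  · filter_upwards [ae_restrict_mem measurableSet_Ioc] with s hs
    exact inv_nonneg.2 (ha.le.trans hs.1.le)

theorem lintegral_radial_le {n : ℕ} (hn : 1 ≤ n) {h : Vec n → ℝ≥0∞} (hh : Measurable h) :
    ∫⁻ ω, (∫⁻ s in Ioi (1 / 2 : ℝ), h (s • ω)) ∂coneMeasure n
      ≤ ENNReal.ofReal (2 ^ (n - 1)) * ∫⁻ x, h x := by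
  have hm : Measurable fun q : Vec n × ℝ => ENNReal.ofReal (q.2 ^ (n - 1)) * h (q.2 • q.1) := by
    fun_prop
  rw [lintegral_polar hn hh, ← lintegral_const_mul _ hm.lintegral_prod_right']
  refine lintegral_mono fun ω => ?_
  rw [← lintegral_const_mul _ (by fun_prop)]
  refine le_trans (setLIntegral_mono (by fun_prop) fun s hs => ?_)
    (lintegral_mono_set (Ioi_subset_Ioi (by norm_num : (0 : ℝ) ≤ 1 / 2)))
  rw [← mul_assoc, ← ENNReal.ofReal_mul (by positivity), ← mul_pow]
  refine le_mul_of_one_le_left zero_le ?_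
  rw [← ENNReal.ofReal_one]
  refine ENNReal.ofReal_le_ofReal (one_le_pow₀ ?_)
  have : (1 / 2 : ℝ) < s := hs
  linarith

/-! ### The Carleson estimate for the logarithmic derivative -/

/-- The operator norm of `Df / |f|`, extended by zero outside the unit ball. -/
def logDer {n : ℕ} (f : Vec n → Vec n) : Vec n → ℝ≥0∞ :=
  (unitBall n).indicator fun x => ENNReal.ofReal (‖fderiv ℝ f x‖ / ‖f x‖)

theorem measurableSet_unitBall (n : ℕ) : MeasurableSet (unitBall n) := measurableSet_ball

theorem mem_unitBall {n : ℕ} {x : Vec n} : x ∈ unitBall n ↔ ‖x‖ < 1 := by simp [unitBall]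

theorem measurable_indicator_unitBall {n : ℕ} {f : Vec n → Vec n}
    (hf : ContinuousOn f (unitBall n)) : Measurable ((unitBall n).indicator f) := by
  have := hf.measurable_piecewise (g := 0) continuousOn_const (measurableSet_unitBall n)
  rwa [piecewise_eq_indicator] at this

theorem measurable_logDer {n : ℕ} {f : Vec n → Vec n} (hf : ContinuousOn f (unitBall n)) :
    Measurable (logDer f) := by
  have h1 := measurable_indicator_unitBall hf
  have h2 := measurable_fderiv ℝ f
  have : logDer f = (unitBall n).indicator
      fun x => ENNReal.ofReal (‖fderiv ℝ f x‖ / ‖(unitBall n).indicator f x‖) := by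
    ext x
    by_cases hx : x ∈ unitBall n <;> simp [logDer, hx]
  rw [this]
  exact Measurable.indicator (by fun_prop) (measurableSet_unitBall n)

theorem lintegral_logDer_pow_le {n : ℕ} (hn : 1 ≤ n) {K C₀ α a C₁ : ℝ} (hK : 0 ≤ K)
    (hC₀ : 1 ≤ C₀) (hα : 0 ≤ α) (hC₁ : 0 ≤ C₁) {f : Vec n → Vec n} (hf : IsQR n K f)
    (hf0 : ∀ x ∈ unitBall n, f x ≠ 0) (hMin : InMiniowitz n C₀ α f) (hM : MultCond n a C₁ f)
    {x : Vec n} (hx : ‖x‖ < 1) {t : ℝ} (ht : 0 < t) (ht1 : t ≤ 1) {s : Set (Vec n)}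
    (hsm : MeasurableSet s) (hs : ∀ z ∈ s, ‖z‖ < 1 ∧
      t * mobiusDen x z ≤ (1 - ‖x‖ ^ 2) * (1 - ‖z‖ ^ 2)) :
    ∫⁻ z in s, logDer f z ^ n ≤
      ENNReal.ofReal (K * (C₁ / (t / 4) ^ a) * (2 * Real.log (C₀ * (4 / t) ^ α)))
        * coneMeasure n univ := by
  set M := C₀ * (4 / t) ^ α with hMdef
  have hM1 : 1 ≤ M := by
    refine one_le_mul_of_one_le_of_one_le hC₀ (Real.one_le_rpow ?_ hα)
    rw [le_div_iff₀ ht]; linarith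
  have hM0 : 0 < M := zero_lt_one.trans_le hM1
  have hfx : 0 < ‖f x‖ := norm_pos_iff.2 (hf0 x (mem_unitBall.2 hx))
  set R : Set (Vec n) := {y | ‖y‖ ∈ Icc (M⁻¹ * ‖f x‖) (M * ‖f x‖)}
  have hR : MapsTo f s R := fun z hz => by
    obtain ⟨hz1, hz2⟩ := hs z hz
    refine ⟨?_, hMin.norm_le (by linarith) hα hf0 hx hz1 ht hz2⟩
    rw [inv_mul_le_iff₀ hM0]
    refine hMin.norm_le (by linarith) hα hf0 hz1 hx ht ?_
    rw [mobiusDen_comm]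
    linarith
  have hsB : s ⊆ unitBall n := fun z hz => mem_unitBall.2 (hs z hz).1
  calc ∫⁻ z in s, logDer f z ^ n
      ≤ ∫⁻ z in s, ENNReal.ofReal K * (ENNReal.ofReal |(fderiv ℝ f z).det| *
          (ENNReal.ofReal (‖f z‖ ^ n))⁻¹) := by
        refine lintegral_mono_ae ?_
        filter_upwards [ae_restrict_mem hsm, ae_restrict_of_ae_restrict_of_subset hsB hf.2.2]
          with z hz hz1
        have hz0 : 0 < ‖f z‖ := norm_pos_iff.2 (hf0 z (hsB hz))
        rw [logDer, indicator_of_mem (hsB hz), ← ENNReal.ofReal_pow (by positivity),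
          ← ENNReal.ofReal_inv_of_pos (by positivity), ← ENNReal.ofReal_mul (by positivity),
          ← ENNReal.ofReal_mul (by positivity), div_pow, div_eq_mul_inv, ← mul_assoc]
        refine ENNReal.ofReal_le_ofReal (mul_le_mul_of_nonneg_right ?_ (by positivity))
        exact hz1.trans (mul_le_mul_of_nonneg_left (le_abs_self _) hK)
    _ = ENNReal.ofReal K * ∫⁻ z in s, ENNReal.ofReal |(fderiv ℝ f z).det| *
          (ENNReal.ofReal (‖f z‖ ^ n))⁻¹ := lintegral_const_mul' _ _ ENNReal.ofReal_ne_top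
    _ ≤ ENNReal.ofReal K * (ENNReal.ofReal (C₁ / (t / 4) ^ a) *
          ∫⁻ y in R, (ENNReal.ofReal (‖y‖ ^ n))⁻¹) := by
        gcongr
        exact lintegral_abs_det_fderiv_mul_le volume hsm (fun z hz => hf.2.1 z (hsB hz)) hR
          (hM.encard_le hx ht ht1 hs) (g := fun y => (ENNReal.ofReal (‖y‖ ^ n))⁻¹) (by fun_prop)
    _ = _ := by
        rw [lintegral_annulus_inv_norm_pow hn (by positivity)
          (mul_le_mul_of_nonneg_right ((inv_le_one_of_one_le₀ hM1).trans hM1) hfx.le),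
          ← mul_assoc, ← mul_assoc, ← ENNReal.ofReal_mul hK,
          ← ENNReal.ofReal_mul (mul_nonneg hK (by positivity))]
        congr 3
        rw [mul_div_mul_right _ _ hfx.ne', div_inv_eq_mul, Real.log_mul hM0.ne' hM0.ne', two_mul]

theorem volume_carleson_layer_le {n : ℕ} (hn : 1 ≤ n) {ω : Vec n} (hω : ‖ω‖ = 1) {ρ τ : ℝ}
    (hρ : 0 < ρ) (hτ : 0 < τ) :
    volume {z : Vec n | ‖z‖ < 1 ∧ ‖z - ω‖ < ρ ∧ 1 - ‖z‖ ≤ τ} ≤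
      ENNReal.ofReal (4 ^ n * ρ ^ (n - 1) * τ) * volume (ball (0 : Vec n) 1) := by
  have := nontrivial_vec hn
  have hsub : {z : Vec n | ‖z‖ < 1 ∧ ‖z - ω‖ < ρ ∧ 1 - ‖z‖ ≤ τ} ⊆
      {z : Vec n | ‖z‖ ∈ Ico (1 - τ) 1 ∧ ‖z‖⁻¹ • z ∈ ball ω (2 * ρ)} ∪ {0} := by
    rintro z ⟨h1, h2, h3⟩
    by_cases hz : z = 0
    · exact Or.inr hz
    · refine Or.inl ⟨⟨by linarith, h1⟩, ?_⟩
      have h4 := norm_inv_smul_sub_eq hz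
      rw [abs_of_pos (by linarith)] at h4
      have h5 := norm_sub_le_norm_sub_add_norm_sub (‖z‖⁻¹ • z) z ω
      have h6 := abs_le.1 (abs_norm_sub_norm_le z ω)
      rw [hω] at h6
      rw [mem_ball, dist_eq_norm]
      linarith
  calc _ ≤ _ := measure_mono hsub
    _ ≤ _ := measure_union_le _ _
    _ = _ := by rw [measure_singleton, add_zero, volume_sector hn measurableSet_ball
        measurableSet_Ico]
    _ ≤ ENNReal.ofReal τ * (ENNReal.ofReal (2 ^ n * (2 * ρ) ^ (n - 1)) *
          volume (ball (0 : Vec n) 1)) := by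
        gcongr
        · calc _ ≤ ∫⁻ s in Ico (1 - τ) 1 ∩ Ioi 0, (1 : ℝ≥0∞) := by
                refine setLIntegral_mono (by fun_prop) fun s hs => ?_
                rw [← ENNReal.ofReal_one]
                exact ENNReal.ofReal_le_ofReal (pow_le_one₀ (le_of_lt hs.2) hs.1.2.le)
            _ ≤ ∫⁻ s in Ico (1 - τ) 1, (1 : ℝ≥0∞) := lintegral_mono_set inter_subset_left
            _ = _ := by simp
        · exact coneMeasure_ball_le hn hω (by positivity)
    _ ≤ _ := by
        rw [← mul_assoc, ← ENNReal.ofReal_mul hτ.le]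
        refine mul_le_mul_left (ENNReal.ofReal_le_ofReal ?_) _
        calc τ * (2 ^ n * (2 * ρ) ^ (n - 1)) = 2 ^ n * 2 ^ (n - 1) * ρ ^ (n - 1) * τ := by
              rw [mul_pow]; ring
          _ ≤ 2 ^ n * 2 ^ n * ρ ^ (n - 1) * τ := by
              gcongr
              · norm_num
              · omega
          _ = 4 ^ n * ρ ^ (n - 1) * τ := by rw [← mul_pow]; norm_num

/-- A form of Young's inequality avoiding fractional exponents. -/
theorem ENNReal.le_add_pow_div {n : ℕ} (hn : 1 ≤ n) (w : ℝ≥0∞) {θ : ℝ} (hθ : 0 < θ) :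
    w ≤ ENNReal.ofReal θ + ENNReal.ofReal ((θ ^ (n - 1))⁻¹) * w ^ n := by
  rcases le_total w (ENNReal.ofReal θ) with h | h
  · exact h.trans le_self_add
  · refine le_add_left ?_
    obtain ⟨m, rfl⟩ := Nat.exists_eq_add_of_le' hn
    rw [Nat.add_sub_cancel, pow_succ, ← mul_assoc]
    refine le_mul_of_one_le_left zero_le ?_
    calc (1 : ℝ≥0∞) = ENNReal.ofReal ((θ ^ m)⁻¹) * ENNReal.ofReal θ ^ m := by
          rw [← ENNReal.ofReal_pow hθ.le, ← ENNReal.ofReal_mul (by positivity),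
            inv_mul_cancel₀ (by positivity), ENNReal.ofReal_one]
      _ ≤ _ := by gcongr

/-- The part of the Carleson region of size `6 δ` at `ω` at distance about `6 · 2⁻ʲ δ` from the
sphere. -/
def carlesonLayer {n : ℕ} (ω : Vec n) (δ : ℝ) (j : ℕ) : Set (Vec n) :=
  {z | ‖z‖ < 1 ∧ ‖z - ω‖ < 6 * δ ∧ 6 * (1 / 2) ^ (j + 1) * δ < 1 - ‖z‖ ∧
    1 - ‖z‖ ≤ 6 * (1 / 2) ^ j * δ}

theorem measurableSet_carlesonLayer {n : ℕ} (ω : Vec n) (δ : ℝ) (j : ℕ) :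
    MeasurableSet (carlesonLayer ω δ j) := by
  have h1 : MeasurableSet {z : Vec n | ‖z‖ < 1} := measurableSet_lt (by fun_prop) (by fun_prop)
  have h2 : MeasurableSet {z : Vec n | ‖z - ω‖ < 6 * δ} :=
    measurableSet_lt (by fun_prop) (by fun_prop)
  have h3 : MeasurableSet {z : Vec n | 6 * (1 / 2) ^ (j + 1) * δ < 1 - ‖z‖} :=
    measurableSet_lt (by fun_prop) (by fun_prop)
  have h4 : MeasurableSet {z : Vec n | 1 - ‖z‖ ≤ 6 * (1 / 2) ^ j * δ} :=
    measurableSet_le (by fun_prop) (by fun_prop)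
  exact h1.inter (h2.inter (h3.inter h4))

theorem subset_iUnion_carlesonLayer {n : ℕ} {ω : Vec n} (hω : ‖ω‖ = 1) {δ : ℝ} (hδ : 0 < δ) :
    {z : Vec n | ‖z‖ < 1 ∧ ‖z - ω‖ < 6 * δ} ⊆ ⋃ j, carlesonLayer ω δ j := by
  rintro z ⟨h1, h2⟩
  have h6 := abs_le.1 (abs_norm_sub_norm_le z ω)
  rw [hω] at h6
  have hpos : 0 < (1 - ‖z‖) / (6 * δ) := div_pos (by linarith) (by linarith)
  have hle : (1 - ‖z‖) / (6 * δ) < 1 := by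
    rw [div_lt_one (by linarith)]
    linarith
  obtain ⟨j, hj1, hj2⟩ := exists_nat_pow_near_of_lt_one hpos hle.le
    (by norm_num : (0 : ℝ) < 1 / 2) (by norm_num)
  rw [lt_div_iff₀ (by linarith)] at hj1
  rw [div_le_iff₀ (by linarith)] at hj2
  exact mem_iUnion.2 ⟨j, h1, h2, by linarith, by linarith⟩

theorem mobiusDen_le_of_mem_carlesonLayer {n : ℕ} {ω : Vec n} (hω : ‖ω‖ = 1) {δ : ℝ} (hδ : 0 < δ)
    (hδ1 : δ ≤ 1) {j : ℕ} {z : Vec n} (hz : z ∈ carlesonLayer ω δ j) :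
    (1 / 2) ^ j / 32 * mobiusDen ((1 - δ) • ω) z ≤
      (1 - ‖(1 - δ) • ω‖ ^ 2) * (1 - ‖z‖ ^ 2) := by
  obtain ⟨h1, h2, h3, -⟩ := hz
  have hx : ‖(1 - δ) • ω‖ = 1 - δ := by
    rw [norm_smul, hω, mul_one, Real.norm_eq_abs, abs_of_nonneg (by linarith)]
  have h6 := abs_le.1 (abs_norm_sub_norm_le z ω)
  rw [hω] at h6
  have h7 : ‖z - (1 - δ) • ω‖ ≤ 7 * δ := by
    have h8 : z - (1 - δ) • ω = (z - ω) + δ • ω := by module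
    have h9 : ‖δ • ω‖ = δ := by rw [norm_smul, hω, mul_one, Real.norm_eq_abs, abs_of_pos hδ]
    rw [h8]
    linarith [norm_add_le (z - ω) (δ • ω)]
  have h0 := norm_nonneg z
  have hD : mobiusDen ((1 - δ) • ω) z ≤ 73 * δ ^ 2 := by
    rw [mobiusDen, hx]
    have e1 : ‖z - (1 - δ) • ω‖ ^ 2 ≤ (7 * δ) ^ 2 := pow_le_pow_left₀ (norm_nonneg _) h7 2
    have e2 : (1 - (1 - δ) ^ 2) ≤ 2 * δ := by nlinarith
    have e3 : 1 - ‖z‖ ^ 2 ≤ 12 * δ := by nlinarith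
    have e4 : (1 - (1 - δ) ^ 2) * (1 - ‖z‖ ^ 2) ≤ 2 * δ * (12 * δ) :=
      mul_le_mul e2 e3 (by nlinarith) (by linarith)
    linarith
  have hp : (0 : ℝ) < (1 / 2) ^ j := by positivity
  rw [pow_succ] at h3
  rw [hx]
  have e2 : δ ≤ 1 - (1 - δ) ^ 2 := by nlinarith
  have e3 : 3 * (1 / 2) ^ j * δ ≤ 1 - ‖z‖ ^ 2 := by nlinarith
  calc _ ≤ (1 / 2) ^ j / 32 * (73 * δ ^ 2) := by gcongr
    _ ≤ δ * (3 * (1 / 2) ^ j * δ) := by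
        have : 0 < (1 / 2 : ℝ) ^ j * δ ^ 2 := by positivity
        nlinarith
    _ ≤ _ := mul_le_mul e2 e3 (by positivity) (hδ.le.trans e2)

theorem exists_carleson_bound {n : ℕ} (hn : 2 ≤ n) {K C₀ α a C₁ : ℝ} (hK : 1 ≤ K)
    (hC₀ : 1 ≤ C₀) (hα : 0 < α) (ha0 : 0 ≤ a) (ha : a < (n : ℝ) - 1) (hC₁ : 0 < C₁) :
    ∃ A : ℝ, 0 < A ∧ ∀ f : Vec n → Vec n, IsQR n K f → (∀ x ∈ unitBall n, f x ≠ 0) →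
      InMiniowitz n C₀ α f → MultCond n a C₁ f → ∀ ω : Vec n, ‖ω‖ = 1 → ∀ δ : ℝ, 0 < δ → δ ≤ 1 →
      ∫⁻ z in {z : Vec n | ‖z‖ < 1 ∧ ‖z - ω‖ < 6 * δ}, logDer f z ≤
        ENNReal.ofReal (A * δ ^ (n - 1)) := by
  have hn1 : 1 ≤ n := by omega
  have hn0 : (0 : ℝ) < (n : ℝ) - 1 := by linarith
  have hcast : ((n - 1 : ℕ) : ℝ) = (n : ℝ) - 1 := by push_cast [Nat.cast_sub hn1]; ring
  obtain ⟨q, hq1, hq2⟩ : ∃ q : ℝ, (2 : ℝ) ^ (a / ((n : ℝ) - 1)) < q ∧ q < 2 := by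
    refine exists_between ?_
    nth_rewrite 2 [← Real.rpow_one 2]
    exact Real.rpow_lt_rpow_of_exponent_lt (by norm_num) ((div_lt_one hn0).2 ha)
  have hq0 : 0 < q := lt_trans (by positivity) hq1
  have hqa : (2 : ℝ) ^ a / q ^ (n - 1) < 1 := by
    rw [div_lt_one (by positivity)]
    calc (2 : ℝ) ^ a = ((2 : ℝ) ^ (a / ((n : ℝ) - 1))) ^ (n - 1) := by
          rw [← Real.rpow_natCast, ← Real.rpow_mul (by norm_num), hcast, div_mul_cancel₀ _ hn0.ne']
      _ < q ^ (n - 1) := pow_lt_pow_left₀ hq1 (by positivity) (by omega)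
  set V := (volume (ball (0 : Vec n) 1)).toReal with hV
  set S := (coneMeasure n univ).toReal with hS
  have hVe : volume (ball (0 : Vec n) 1) = ENNReal.ofReal V :=
    (ENNReal.ofReal_toReal measure_ball_lt_top.ne).symm
  have hSe : coneMeasure n univ = ENNReal.ofReal S :=
    (ENNReal.ofReal_toReal (measure_ne_top _ _)).symm
  have hV0 : 0 ≤ V := ENNReal.toReal_nonneg
  have hS0 : 0 ≤ S := ENNReal.toReal_nonneg
  set r := (2 : ℝ) ^ a / q ^ (n - 1) with hr
  have hr0 : 0 ≤ r := by positivity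
  set T : ℕ → ℝ := fun j => 24 ^ n * V * (q / 2) ^ j +
    K * (C₁ * 128 ^ a) * (2 * (Real.log C₀ + α * (Real.log 128 + j * Real.log 2))) * S * r ^ j
    with hT
  have hT0 : ∀ j, 0 ≤ T j := fun j => by
    have := Real.log_nonneg hC₀
    have := Real.log_nonneg (by norm_num : (1 : ℝ) ≤ 128)
    have := Real.log_nonneg (by norm_num : (1 : ℝ) ≤ 2)
    simp only [hT]
    positivity
  have hTs : Summable T := by
    have h1 : Summable fun j : ℕ => (q / 2) ^ j :=
      summable_geometric_of_lt_one (by positivity) (by linarith)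
    have h2 : Summable fun j : ℕ => r ^ j := summable_geometric_of_lt_one hr0 hqa
    have h3 : Summable fun j : ℕ => (j : ℝ) * r ^ j := by
      simpa using summable_pow_mul_geometric_of_norm_lt_one 1
        (by rwa [Real.norm_eq_abs, abs_of_nonneg hr0] : ‖r‖ < 1)
    have h4 := ((h1.mul_left (24 ^ n * V)).add
      (h2.mul_left (K * (C₁ * 128 ^ a) * (2 * (Real.log C₀ + α * Real.log 128)) * S))).add
      (h3.mul_left (K * (C₁ * 128 ^ a) * (2 * (α * Real.log 2)) * S))
    refine h4.congr fun j => ?_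
    simp only [hT]
    ring
  refine ⟨(∑' j, T j) + 1, add_pos_of_nonneg_of_pos (tsum_nonneg hT0) one_pos, ?_⟩
  intro f hf hf0 hMin hM ω hω δ hδ hδ1
  have hlayer : ∀ j, ∫⁻ z in carlesonLayer ω δ j, logDer f z ≤
      ENNReal.ofReal (δ ^ (n - 1) * T j) := by
    intro j
    have hx : ‖(1 - δ) • ω‖ < 1 := by
      rw [norm_smul, hω, mul_one, Real.norm_eq_abs, abs_of_nonneg (by linarith)]
      linarith
    have hp1 : (1 / 2 : ℝ) ^ j ≤ 1 := pow_le_one₀ (by norm_num) (by norm_num)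
    have hE := lintegral_logDer_pow_le hn1 (by linarith) hC₀ hα.le hC₁.le hf hf0 hMin hM hx
      (t := (1 / 2) ^ j / 32) (by positivity) (by linarith)
      (measurableSet_carlesonLayer ω δ j)
      fun z hz => ⟨hz.1, mobiusDen_le_of_mem_carlesonLayer hω hδ hδ1 hz⟩
    have hvol : volume (carlesonLayer ω δ j) ≤
        ENNReal.ofReal ((24 * δ) ^ n * (1 / 2) ^ j * V) := by
      calc _ ≤ volume {z : Vec n | ‖z‖ < 1 ∧ ‖z - ω‖ < 6 * δ ∧ 1 - ‖z‖ ≤ 6 * (1 / 2) ^ j * δ} :=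
            measure_mono fun z hz => ⟨hz.1, hz.2.1, hz.2.2.2⟩
        _ ≤ _ := volume_carleson_layer_le hn1 hω (by positivity) (by positivity)
        _ = _ := by
            rw [hVe, ← ENNReal.ofReal_mul (by positivity)]
            congr 1
            obtain ⟨m, rfl⟩ := Nat.exists_eq_add_of_le' hn1
            simp only [Nat.add_sub_cancel]
            rw [show (24 : ℝ) * δ = 4 * (6 * δ) by ring, mul_pow, mul_pow]
            ring
    have hθ : 0 < δ⁻¹ * q ^ j := by positivity
    have hinv : (1 / 2 : ℝ) ^ j / 32 / 4 = (128 * 2 ^ j)⁻¹ := by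
      rw [one_div, inv_pow, mul_inv]; ring
    have h4t : (4 : ℝ) / ((1 / 2) ^ j / 32) = 128 * 2 ^ j := by
      rw [one_div, inv_pow]; field_simp; norm_num
    have hlog : Real.log (C₀ * (4 / ((1 / 2) ^ j / 32)) ^ α) =
        Real.log C₀ + α * (Real.log 128 + j * Real.log 2) := by
      rw [h4t, Real.log_mul (by positivity) (by positivity), Real.log_rpow (by positivity),
        Real.log_mul (by norm_num) (by positivity), Real.log_pow]
    have hNa : C₁ / ((1 / 2 : ℝ) ^ j / 32 / 4) ^ a = C₁ * 128 ^ a * ((2 : ℝ) ^ a) ^ j := by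
      rw [hinv, Real.inv_rpow (by positivity), div_inv_eq_mul,
        Real.mul_rpow (by norm_num) (by positivity), ← Real.rpow_natCast 2 j,
        ← Real.rpow_mul (by norm_num), mul_comm (j : ℝ) a, Real.rpow_mul (by norm_num),
        Real.rpow_natCast, mul_assoc]
    rw [hlog, hNa, hSe] at hE
    have hlogn : 0 ≤ Real.log C₀ + α * (Real.log 128 + j * Real.log 2) := by
      have := Real.log_nonneg hC₀
      have := Real.log_nonneg (by norm_num : (1 : ℝ) ≤ 128)
      have := Real.log_nonneg (by norm_num : (1 : ℝ) ≤ 2)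
      positivity
    calc ∫⁻ z in carlesonLayer ω δ j, logDer f z
        ≤ ∫⁻ z in carlesonLayer ω δ j, (ENNReal.ofReal (δ⁻¹ * q ^ j) +
            ENNReal.ofReal (((δ⁻¹ * q ^ j) ^ (n - 1))⁻¹) * logDer f z ^ n) :=
          lintegral_mono fun z => ENNReal.le_add_pow_div hn1 _ hθ
      _ = ENNReal.ofReal (δ⁻¹ * q ^ j) * volume (carlesonLayer ω δ j) +
            ENNReal.ofReal (((δ⁻¹ * q ^ j) ^ (n - 1))⁻¹) *
              ∫⁻ z in carlesonLayer ω δ j, logDer f z ^ n := by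
          rw [lintegral_add_left measurable_const, setLIntegral_const,
            lintegral_const_mul' _ _ ENNReal.ofReal_ne_top]
      _ ≤ _ := add_le_add (mul_le_mul_right hvol _) (mul_le_mul_right hE _)
      _ = _ := by
          rw [← ENNReal.ofReal_mul (by positivity), ← ENNReal.ofReal_mul (by positivity),
            ← ENNReal.ofReal_mul (by positivity), ← ENNReal.ofReal_add (by positivity)
              (by positivity)]
          congr 1
          simp only [hT]
          rw [mul_add (δ ^ (n - 1))]
          congr 1
          · obtain ⟨m, rfl⟩ := Nat.exists_eq_add_of_le' hn1
            simp only [Nat.add_sub_cancel]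
            rw [div_pow, div_pow, one_pow, mul_pow, pow_succ δ]
            field_simp
          · rw [hr, div_pow, mul_pow, inv_pow, mul_inv, inv_inv, ← pow_mul, mul_comm j, pow_mul]
            field_simp
  calc ∫⁻ z in {z : Vec n | ‖z‖ < 1 ∧ ‖z - ω‖ < 6 * δ}, logDer f z
      ≤ ∫⁻ z in ⋃ j, carlesonLayer ω δ j, logDer f z :=
        lintegral_mono_set (subset_iUnion_carlesonLayer hω hδ)
    _ ≤ ∑' j, ∫⁻ z in carlesonLayer ω δ j, logDer f z := lintegral_iUnion_le _ _
    _ ≤ ∑' j, ENNReal.ofReal (δ ^ (n - 1) * T j) := ENNReal.tsum_le_tsum hlayer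
    _ = ENNReal.ofReal (δ ^ (n - 1) * ∑' j, T j) := by
        rw [← tsum_mul_left, ENNReal.ofReal_tsum_of_nonneg (fun j => mul_nonneg (by positivity)
          (hT0 j)) (hTs.mul_left _)]
    _ ≤ _ := by
        refine ENNReal.ofReal_le_ofReal ?_
        have : 0 < δ ^ (n - 1) := by positivity
        nlinarith

/-! ### The Carleson embedding -/

theorem setLIntegral_le_of_carleson {n : ℕ} (hn : 1 ≤ n) {A : ℝ} (hA : 0 ≤ A) {w : Vec n → ℝ≥0∞}
    (hw : ∀ ω : Vec n, ‖ω‖ = 1 → ∀ δ : ℝ, 0 < δ → δ ≤ 1 →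
      ∫⁻ z in {z : Vec n | ‖z‖ < 1 ∧ ‖z - ω‖ < 6 * δ}, w z ≤ ENNReal.ofReal (A * δ ^ (n - 1)))
    {E U : Set (Vec n)} (hE : ∀ x ∈ E, 0 < ‖x‖ ∧ ‖x‖ < 1)
    (hU : ∀ x ∈ E, ∀ η : Vec n, ‖η‖ = 1 → dist η (‖x‖⁻¹ • x) < (1 - ‖x‖) / 2 → η ∈ U) :
    volume (ball (0 : Vec n) 1) * ∫⁻ z in E, w z ≤
      ENNReal.ofReal (A * 8 ^ n) * coneMeasure n U := by
  obtain ⟨u, huE, hud, huc⟩ := Vitali.exists_disjoint_subfamily_covering_enlargement_closedBall E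
    (fun x : Vec n => ‖x‖⁻¹ • x) (fun x => 1 - ‖x‖) 1
    (fun x _ => by linarith [norm_nonneg x]) 5 (by norm_num)
  have hunit : ∀ x ∈ E, ‖‖x‖⁻¹ • x‖ = 1 := fun x hx => by
    rw [norm_smul, norm_inv, norm_norm, inv_mul_cancel₀ (hE x hx).1.ne']
  have hcount : u.Countable := by
    refine hud.countable_of_nonempty_interior fun x hx => ?_
    refine ⟨‖x‖⁻¹ • x, ball_subset_interior_closedBall (mem_ball_self ?_)⟩
    linarith [(hE x (huE hx)).2]
  have : Countable u := hcount
  have hcov : E ⊆ ⋃ b : u, {z : Vec n | ‖z‖ < 1 ∧ ‖z - ‖b.1‖⁻¹ • b.1‖ < 6 * (1 - ‖b.1‖)} := by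
    intro x hx
    obtain ⟨b, hb, hsub⟩ := huc x hx
    have hx0 : x ≠ 0 := norm_pos_iff.1 (hE x hx).1
    have hmem : x ∈ closedBall (‖x‖⁻¹ • x) (1 - ‖x‖) := by
      rw [mem_closedBall, dist_comm, dist_eq_norm, norm_inv_smul_sub_eq hx0,
        abs_of_pos (by linarith [(hE x hx).2])]
    have h5 := hsub hmem
    rw [mem_closedBall, dist_eq_norm] at h5
    have := (hE b (huE hb)).2
    exact mem_iUnion.2 ⟨⟨b, hb⟩, (hE x hx).2, by dsimp only; linarith⟩
  have hdisj : Pairwise (Function.onFun Disjoint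
      fun b : u => ball (‖b.1‖⁻¹ • b.1) ((1 - ‖b.1‖) / 2)) := by
    intro b c hbc
    refine (hud b.2 c.2 fun h => hbc (Subtype.ext h)).mono ?_ ?_
    · exact ball_subset_closedBall.trans (closedBall_subset_closedBall
        (by linarith [(hE b (huE b.2)).2]))
    · exact ball_subset_closedBall.trans (closedBall_subset_closedBall
        (by linarith [(hE c (huE c.2)).2]))
  calc volume (ball (0 : Vec n) 1) * ∫⁻ z in E, w z
      ≤ volume (ball (0 : Vec n) 1) *
          ∑' b : u, ∫⁻ z in {z : Vec n | ‖z‖ < 1 ∧ ‖z - ‖b.1‖⁻¹ • b.1‖ < 6 * (1 - ‖b.1‖)}, w z := by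
        gcongr
        exact (lintegral_mono_set hcov).trans (lintegral_iUnion_le _ _)
    _ = ∑' b : u, volume (ball (0 : Vec n) 1) *
          ∫⁻ z in {z : Vec n | ‖z‖ < 1 ∧ ‖z - ‖b.1‖⁻¹ • b.1‖ < 6 * (1 - ‖b.1‖)}, w z :=
        ENNReal.tsum_mul_left.symm
    _ ≤ ∑' b : u, ENNReal.ofReal (A * 8 ^ n) *
          coneMeasure n (ball (‖b.1‖⁻¹ • b.1) ((1 - ‖b.1‖) / 2)) := by
        refine ENNReal.tsum_le_tsum fun b => ?_
        obtain ⟨hb0, hb1⟩ := hE b (huE b.2)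
        have h1 := hw _ (hunit b (huE b.2)) (1 - ‖b.1‖) (by linarith) (by linarith)
        have h2 := le_coneMeasure_ball hn (hunit b (huE b.2)) (ρ := (1 - ‖b.1‖) / 2)
          (by linarith) (by linarith)
        have hb2 : 0 ≤ 1 - ‖b.1‖ := by linarith
        calc _ ≤ volume (ball (0 : Vec n) 1) * ENNReal.ofReal (A * (1 - ‖b.1‖) ^ (n - 1)) := by
              gcongr
          _ ≤ ENNReal.ofReal (A * 2 ^ n) * (ENNReal.ofReal (((1 - ‖b.1‖) / 2) ^ (n - 1)) *
                volume (ball (0 : Vec n) 1)) := by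
              rw [mul_comm, ← mul_assoc, ← ENNReal.ofReal_mul (by positivity)]
              refine mul_le_mul_left (ENNReal.ofReal_le_ofReal ?_) _
              rw [div_pow, mul_assoc]
              refine mul_le_mul_of_nonneg_left ?_ hA
              rw [mul_div_assoc', le_div_iff₀ (by positivity), mul_comm]
              refine mul_le_mul_of_nonneg_right ?_ (by positivity)
              exact pow_le_pow_right₀ (by norm_num) (by omega)
          _ ≤ ENNReal.ofReal (A * 2 ^ n) * (ENNReal.ofReal (4 ^ n) *
                coneMeasure n (ball (‖b.1‖⁻¹ • b.1) ((1 - ‖b.1‖) / 2))) := by gcongr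
          _ = _ := by
              rw [← mul_assoc, ← ENNReal.ofReal_mul (by positivity), mul_assoc A, ← mul_pow]
              norm_num
    _ = ENNReal.ofReal (A * 8 ^ n) *
          coneMeasure n (⋃ b : u, ball (‖b.1‖⁻¹ • b.1) ((1 - ‖b.1‖) / 2)) := by
        rw [ENNReal.tsum_mul_left, measure_iUnion hdisj fun b => measurableSet_ball]
    _ ≤ _ := by
        refine mul_le_mul_right (measure_mono_ae ?_) _
        filter_upwards [ae_norm_eq_one_coneMeasure n] with η hη hmem
        obtain ⟨b, hb⟩ := mem_iUnion.1 hmem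
        exact hU b (huE b.2) η hη hb

theorem lintegral_meas_ofReal_lt_le {X : Type*} [MeasurableSpace X] (μ : Measure X)
    {G : X → ℝ≥0∞} (hG : Measurable G) :
    ∫⁻ t in Ioi (0 : ℝ), μ {x | ENNReal.ofReal t < G x} ≤ ∫⁻ x, G x ∂μ := by
  by_cases hfin : ∫⁻ x, G x ∂μ = ⊤
  · simp [hfin]
  have hae := ae_lt_top hG hfin
  have h1 : ∫⁻ x, G x ∂μ = ∫⁻ x, ENNReal.ofReal (G x).toReal ∂μ :=
    lintegral_congr_ae (hae.mono fun x hx => (ENNReal.ofReal_toReal hx.ne).symm)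
  rw [h1, lintegral_eq_lintegral_meas_lt μ (Filter.Eventually.of_forall fun x =>
    ENNReal.toReal_nonneg) hG.ennreal_toReal.aemeasurable]
  refine setLIntegral_mono' measurableSet_Ioi fun t ht => measure_mono_ae ?_
  filter_upwards [hae] with x hx hlt
  exact (ENNReal.ofReal_lt_iff_lt_toReal (le_of_lt ht) hx.ne).1 hlt

theorem carleson_embedding {n : ℕ} (hn : 1 ≤ n) {A : ℝ} (hA : 0 ≤ A) {w : Vec n → ℝ≥0∞}
    (hwm : Measurable w)
    (hw : ∀ ω : Vec n, ‖ω‖ = 1 → ∀ δ : ℝ, 0 < δ → δ ≤ 1 →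
      ∫⁻ z in {z : Vec n | ‖z‖ < 1 ∧ ‖z - ω‖ < 6 * δ}, w z ≤ ENNReal.ofReal (A * δ ^ (n - 1)))
    {E : Set (Vec n)} (hE : ∀ x ∈ E, 0 < ‖x‖ ∧ ‖x‖ < 1)
    {v : Vec n → ℝ} (hv : Measurable v) (hv0 : ∀ x, 0 ≤ v x) {G : Vec n → ℝ≥0∞}
    (hG : Measurable G)
    (hvG : ∀ x ∈ E, ∀ η : Vec n, ‖η‖ = 1 → dist η (‖x‖⁻¹ • x) < (1 - ‖x‖) / 2 →
      ENNReal.ofReal (v x) ≤ G η) :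
    volume (ball (0 : Vec n) 1) * ∫⁻ x in E, ENNReal.ofReal (v x) * w x ≤
      ENNReal.ofReal (A * 8 ^ n) * ∫⁻ η, G η ∂coneMeasure n := by
  have h1 : ∫⁻ x in E, ENNReal.ofReal (v x) * w x
      = ∫⁻ t in Ioi (0 : ℝ), ∫⁻ x in E ∩ {x | t < v x}, w x := by
    have := lintegral_withDensity_eq_lintegral_mul (volume.restrict E) hwm
      (g := fun x => ENNReal.ofReal (v x)) (by fun_prop)
    simp only [Pi.mul_apply] at this
    simp_rw [mul_comm (ENNReal.ofReal (v _))]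
    rw [← this, lintegral_eq_lintegral_meas_lt _ (Filter.Eventually.of_forall hv0)
      hv.aemeasurable]
    refine lintegral_congr fun t => ?_
    have hm : MeasurableSet {x | t < v x} := measurableSet_lt measurable_const hv
    rw [withDensity_apply _ hm, Measure.restrict_restrict hm, inter_comm]
  have hV : volume (ball (0 : Vec n) 1) ≠ ⊤ := measure_ball_lt_top.ne
  rw [h1, ← lintegral_const_mul' _ _ hV]
  calc _ ≤ ∫⁻ t in Ioi (0 : ℝ), ENNReal.ofReal (A * 8 ^ n) *
        coneMeasure n {η | ENNReal.ofReal t < G η} := by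
        refine setLIntegral_mono' measurableSet_Ioi fun t ht => ?_
        refine setLIntegral_le_of_carleson hn hA hw (fun x hx => hE x hx.1) ?_
        intro x hx η hη hd
        refine lt_of_lt_of_le ?_ (hvG x hx.1 η hη hd)
        exact (ENNReal.ofReal_lt_ofReal_iff ((show (0 : ℝ) < t from ht).trans hx.2)).2 hx.2
    _ = _ := lintegral_const_mul' _ _ ENNReal.ofReal_ne_top
    _ ≤ _ := mul_le_mul_right (lintegral_meas_ofReal_lt_le _ hG) _

/-! ### Radial growth -/

/-- The function `|f|ᵖ`, extended by zero outside the unit ball. -/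
def normPow {n : ℕ} (f : Vec n → Vec n) (p : ℝ) : Vec n → ℝ :=
  (unitBall n).indicator fun x => ‖f x‖ ^ p

theorem measurable_normPow {n : ℕ} {f : Vec n → Vec n} (hf : ContinuousOn f (unitBall n)) (p : ℝ) :
    Measurable (normPow f p) := by
  have h1 := measurable_indicator_unitBall hf
  have : normPow f p = (unitBall n).indicator
      fun x => ‖(unitBall n).indicator f x‖ ^ p := by
    ext x
    by_cases hx : x ∈ unitBall n <;> simp [normPow, hx]
  rw [this]
  exact Measurable.indicator (by fun_prop) (measurableSet_unitBall n)

theorem normPow_nonneg {n : ℕ} (f : Vec n → Vec n) (p : ℝ) (x : Vec n) : 0 ≤ normPow f p x :=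
  indicator_nonneg (fun _ _ => by positivity) _

theorem normPow_of_norm_lt {n : ℕ} (f : Vec n → Vec n) (p : ℝ) {x : Vec n} (hx : ‖x‖ < 1) :
    normPow f p x = ‖f x‖ ^ p := indicator_of_mem (mem_unitBall.2 hx) _

theorem normPow_le_radial {n : ℕ} {f : Vec n → Vec n}
    (hf : ∀ x ∈ unitBall n, DifferentiableAt ℝ f x) (hf0 : ∀ x ∈ unitBall n, f x ≠ 0) {p : ℝ}
    (hp : 0 < p) {η : Vec n} (hη : ‖η‖ = 1) {b s : ℝ} (hb : 0 ≤ b) (hbs : b ≤ s) (hs : s < 1) :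
    ENNReal.ofReal (normPow f p (s • η)) ≤ ENNReal.ofReal (normPow f p (b • η)) +
      ENNReal.ofReal p * ∫⁻ u in Ioc b s, ENNReal.ofReal (normPow f p (u • η)) *
        logDer f (u • η) := by
  have hmem : ∀ u ∈ Icc b s, ‖u • η‖ < 1 := fun u hu => by
    rw [norm_smul, hη, mul_one, Real.norm_eq_abs, abs_of_nonneg (hb.trans hu.1)]
    linarith [hu.2]
  set φ : ℝ → ℝ := fun u => Real.exp (p / 2 * Real.log (‖f (u • η)‖ ^ 2)) with hφ
  have hφeq : ∀ u ∈ Icc b s, normPow f p (u • η) = φ u := fun u hu => by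
    have h0 : 0 < ‖f (u • η)‖ := norm_pos_iff.2 (hf0 _ (mem_unitBall.2 (hmem u hu)))
    rw [normPow_of_norm_lt f p (hmem u hu), Real.rpow_def_of_pos h0, hφ]
    simp only [Real.log_pow]
    congr 1
    push_cast
    ring
  have hder : ∀ u ∈ Icc b s, ∃ d, HasDerivAt φ d u ∧
      |d| ≤ p * (φ u * (‖fderiv ℝ f (u • η)‖ / ‖f (u • η)‖)) := by
    intro u hu
    have hne := hf0 _ (mem_unitBall.2 (hmem u hu))
    have h0 : 0 < ‖f (u • η)‖ := norm_pos_iff.2 hne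
    have hg : HasDerivAt (fun u : ℝ => f (u • η)) (fderiv ℝ f (u • η) η) u := by
      have h1 : HasDerivAt (fun u : ℝ => u • η) η u := by
        simpa using (hasDerivAt_id u).smul_const η
      exact (hf _ (mem_unitBall.2 (hmem u hu))).hasFDerivAt.comp_hasDerivAt u h1
    have h2 := ((hg.norm_sq.log (by positivity)).const_mul (p / 2)).exp
    refine ⟨_, h2, ?_⟩
    have h3 : |inner ℝ (f (u • η)) (fderiv ℝ f (u • η) η)| ≤
        ‖f (u • η)‖ * ‖fderiv ℝ f (u • η)‖ := by
      refine (abs_real_inner_le_norm _ _).trans ?_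
      gcongr
      simpa [hη] using (fderiv ℝ f (u • η)).le_opNorm η
    rw [abs_mul, abs_of_pos (Real.exp_pos _), abs_mul, abs_of_pos (by positivity : 0 < p / 2),
      abs_div, abs_mul, abs_two, abs_of_pos (by positivity : 0 < ‖f (u • η)‖ ^ 2)]
    calc _ ≤ φ u * (p / 2 * (2 * (‖f (u • η)‖ * ‖fderiv ℝ f (u • η)‖) / ‖f (u • η)‖ ^ 2)) := by
          gcongr
      _ = _ := by field_simp
  have hbound : ∀ u ∈ Icc b s, ‖deriv φ u‖ₑ ≤ ENNReal.ofReal p *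
      (ENNReal.ofReal (normPow f p (u • η)) * logDer f (u • η)) := by
    intro u hu
    obtain ⟨d, hd, hle⟩ := hder u hu
    rw [hd.deriv, ← ofReal_norm, Real.norm_eq_abs, logDer,
      indicator_of_mem (mem_unitBall.2 (hmem u hu)),
      ← ENNReal.ofReal_mul (normPow_nonneg _ _ _), ← ENNReal.ofReal_mul hp.le, hφeq u hu]
    exact ENNReal.ofReal_le_ofReal hle
  set I := ∫⁻ u in Ioc b s, ENNReal.ofReal (normPow f p (u • η)) * logDer f (u • η) with hI
  have hJ : ∫⁻ u in Ioc b s, ‖deriv φ u‖ₑ ≤ ENNReal.ofReal p * I := by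
    rw [hI, ← lintegral_const_mul' _ _ ENNReal.ofReal_ne_top]
    exact setLIntegral_mono' measurableSet_Ioc fun u hu => hbound u (Ioc_subset_Icc_self hu)
  by_cases hfin : ENNReal.ofReal p * I = ⊤
  · simp [hfin]
  have hderiv_int : IntervalIntegrable (deriv φ) volume b s := by
    rw [intervalIntegrable_iff_integrableOn_Ioc_of_le hbs]
    exact ⟨(measurable_deriv φ).aestronglyMeasurable, hJ.trans_lt (lt_top_iff_ne_top.2 hfin)⟩
  have hftc := intervalIntegral.integral_eq_sub_of_hasDerivAt (f := φ) (f' := deriv φ)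
    (a := b) (b := s) (fun u hu => by
      rw [uIcc_of_le hbs] at hu
      obtain ⟨d, hd, -⟩ := hder u hu
      exact hd.differentiableAt.hasDerivAt) hderiv_int
  rw [intervalIntegral.integral_of_le hbs] at hftc
  rw [hφeq s ⟨hbs, le_rfl⟩, hφeq b ⟨le_rfl, hbs⟩]
  calc ENNReal.ofReal (φ s) = ENNReal.ofReal (φ b + (φ s - φ b)) := by ring_nf
    _ ≤ ENNReal.ofReal (φ b) + ENNReal.ofReal (φ s - φ b) := ENNReal.ofReal_add_le
    _ ≤ _ := by
        refine add_le_add le_rfl (le_trans ?_ hJ)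
        rw [← hftc]
        exact (Real.ofReal_le_enorm _).trans (enorm_integral_le_lintegral_enorm _)

theorem InMiniowitz.harnack {n : ℕ} {C₀ α : ℝ} {f : Vec n → Vec n} (hC₀ : 0 ≤ C₀) (hα : 0 ≤ α)
    (hf : InMiniowitz n C₀ α f) (hf0 : ∀ x ∈ unitBall n, f x ≠ 0) {x z : Vec n} (hx : ‖x‖ < 1)
    (hz : ‖z - x‖ ≤ (1 - ‖x‖) / 2) :
    ‖f z‖ ≤ C₀ * 6 ^ α * ‖f x‖ ∧ ‖f x‖ ≤ C₀ * 6 ^ α * ‖f z‖ := by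
  have h1 := norm_sub_norm_le z x
  have h0 := norm_nonneg x
  have h0' := norm_nonneg z
  have hz1 : ‖z‖ < 1 := by linarith
  have hD : 2 / 3 * mobiusDen x z ≤ (1 - ‖x‖ ^ 2) * (1 - ‖z‖ ^ 2) := by
    have e1 : ‖z - x‖ ^ 2 ≤ ((1 - ‖x‖) / 2) ^ 2 := pow_le_pow_left₀ (norm_nonneg _) hz 2
    have e2 : 1 - ‖x‖ ≤ 1 - ‖x‖ ^ 2 := by nlinarith
    have e3 : (1 - ‖x‖) / 2 ≤ 1 - ‖z‖ ^ 2 := by nlinarith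
    have e4 : (1 - ‖x‖) * ((1 - ‖x‖) / 2) ≤ (1 - ‖x‖ ^ 2) * (1 - ‖z‖ ^ 2) :=
      mul_le_mul e2 e3 (by linarith) (by nlinarith)
    rw [mobiusDen]
    linarith
  have h6 : (4 : ℝ) / (2 / 3) = 6 := by norm_num
  rw [← h6]
  refine ⟨hf.norm_le hC₀ hα hf0 hx hz1 (by norm_num) hD,
    hf.norm_le hC₀ hα hf0 hz1 hx (by norm_num) ?_⟩
  rw [mobiusDen_comm]
  linarith

theorem rpow_le_mul_rpow {H p x y : ℝ} (hH : 1 ≤ H) (hp : 0 ≤ p) (hp1 : p ≤ 1) (hx : 0 ≤ x)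
    (hy : 0 ≤ y) (h : x ≤ H * y) : x ^ p ≤ H * y ^ p :=
  calc x ^ p ≤ (H * y) ^ p := Real.rpow_le_rpow hx h hp
    _ = H ^ p * y ^ p := Real.mul_rpow (by linarith) hy
    _ ≤ H * y ^ p := by
        refine mul_le_mul_of_nonneg_right ?_ (by positivity)
        simpa using Real.rpow_le_rpow_of_exponent_le hH hp1

theorem one_le_mul_six_rpow {C₀ α : ℝ} (hC₀ : 1 ≤ C₀) (hα : 0 ≤ α) : 1 ≤ C₀ * 6 ^ α :=
  one_le_mul_of_one_le_of_one_le hC₀ (Real.one_le_rpow (by norm_num) hα)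

theorem exists_unit_vec {n : ℕ} (hn : 1 ≤ n) : ∃ ω : Vec n, ‖ω‖ = 1 :=
  ⟨EuclideanSpace.single ⟨0, hn⟩ 1, by simp⟩

/-- The integral means of `|f|ᵖ` over spheres, taken against the cone measure, are bounded. -/
theorem exists_coneMeasure_mean_bound {n : ℕ} (hn : 2 ≤ n) {K C₀ α a C₁ : ℝ} (hK : 1 ≤ K)
    (hC₀ : 1 ≤ C₀) (hα : 0 < α) (ha0 : 0 ≤ a) (ha : a < (n : ℝ) - 1) (hC₁ : 0 < C₁) :
    ∃ p C : ℝ, 0 < p ∧ p ≤ 1 ∧ 0 < C ∧ ∀ f : Vec n → Vec n, IsQR n K f →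
      (∀ x ∈ unitBall n, f x ≠ 0) → InMiniowitz n C₀ α f → MultCond n a C₁ f →
      ∀ R : ℝ, 0 ≤ R → R < 1 →
      ∫⁻ η, ENNReal.ofReal (normPow f p (R • η)) ∂coneMeasure n ≤
        ENNReal.ofReal (C * ‖f 0‖ ^ p) := by
  have hn1 : 1 ≤ n := by omega
  obtain ⟨A, hA, hCar⟩ := exists_carleson_bound hn hK hC₀ hα ha0 ha hC₁
  set H := C₀ * 6 ^ α with hHdef
  have hH : 1 ≤ H := one_le_mul_six_rpow hC₀ hα.le
  have hH0 : 0 < H := zero_lt_one.trans_le hH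
  set V := (volume (ball (0 : Vec n) 1)).toReal with hV
  set S := (coneMeasure n univ).toReal with hS
  have hVe : volume (ball (0 : Vec n) 1) = ENNReal.ofReal V :=
    (ENNReal.ofReal_toReal measure_ball_lt_top.ne).symm
  have hSe : coneMeasure n univ = ENNReal.ofReal S :=
    (ENNReal.ofReal_toReal (measure_ne_top _ _)).symm
  have hV0 : 0 < V := ENNReal.toReal_pos (measure_ball_pos _ _ one_pos).ne' measure_ball_lt_top.ne
  have hS0 : 0 < S := ENNReal.toReal_pos (coneMeasure_univ_ne_zero hn1) (measure_ne_top _ _)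
  set c := A * 8 ^ n * H with hc
  have hc0 : 0 < c := by positivity
  obtain ⟨p, hp, hp1, hpc⟩ : ∃ p : ℝ, 0 < p ∧ p ≤ 1 ∧ c * (p * 2 ^ (n - 1)) ≤ V / 2 := by
    refine ⟨min 1 (V / (2 * c * 2 ^ (n - 1))), lt_min one_pos (by positivity), min_le_left _ _, ?_⟩
    calc _ ≤ c * (V / (2 * c * 2 ^ (n - 1)) * 2 ^ (n - 1)) := by
          gcongr
          exact min_le_right _ _
      _ = V / 2 := by field_simp
  refine ⟨p, 2 * H * S, hp, hp1, by positivity, ?_⟩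
  intro f hf hf0 hMin hM R₀ hR₀ hR₀1
  obtain ⟨R, hR₀R, hR, hR1⟩ : ∃ R, R₀ ≤ R ∧ 1 / 2 ≤ R ∧ R < 1 :=
    ⟨max R₀ (1 / 2), le_max_left _ _, le_max_right _ _, max_lt hR₀1 (by norm_num)⟩
  have hwm := measurable_logDer hf.1
  have hvm := measurable_normPow hf.1 p
  set E : Set (Vec n) := {x | 1 / 2 < ‖x‖ ∧ ‖x‖ ≤ R} with hE
  have hEm : MeasurableSet E :=
    (measurableSet_lt measurable_const measurable_norm).inter
      (measurableSet_le measurable_norm measurable_const)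
  set Φ : Vec n → ℝ≥0∞ := E.indicator fun x => ENNReal.ofReal (normPow f p x) * logDer f x with hΦ
  have hΦm : Measurable Φ := Measurable.indicator (by fun_prop) hEm
  have hΦm2 : Measurable fun q : Vec n × ℝ => Φ (q.2 • q.1) := by fun_prop
  set m₀ := H * ‖f 0‖ ^ p with hm₀
  have hm₀0 : 0 ≤ m₀ := by positivity
  set G : Vec n → ℝ≥0∞ := fun η => ENNReal.ofReal m₀ +
    ENNReal.ofReal p * ∫⁻ u in Ioi (1 / 2 : ℝ), Φ (u • η) with hG
  have hGm : Measurable G := (hΦm2.lintegral_prod_right'.const_mul _).const_add _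
  have hcentre : ∀ x : Vec n, ‖x‖ ≤ 1 / 2 → normPow f p x ≤ m₀ := fun x hx => by
    rw [normPow_of_norm_lt f p (by linarith)]
    exact rpow_le_mul_rpow hH hp.le hp1 (norm_nonneg _) (norm_nonneg _)
      (hMin.harnack (by linarith) hα.le hf0 (x := 0) (by simp) (by simpa using hx)).1
  have hvG : ∀ η : Vec n, ‖η‖ = 1 → ∀ s : ℝ, 0 ≤ s → s ≤ R →
      ENNReal.ofReal (normPow f p (s • η)) ≤ G η := by
    intro η hη s hs hsR
    have hnorm : ∀ u : ℝ, 0 ≤ u → ‖u • η‖ = u := fun u hu => by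
      rw [norm_smul, hη, mul_one, Real.norm_eq_abs, abs_of_nonneg hu]
    rcases le_total s (1 / 2) with h | h
    · exact (ENNReal.ofReal_le_ofReal (hcentre _ (by rwa [hnorm s hs]))).trans le_self_add
    · refine (normPow_le_radial hf.2.1 hf0 hp hη (by norm_num : (0 : ℝ) ≤ 1 / 2) h
        (hsR.trans_lt hR1)).trans (add_le_add (ENNReal.ofReal_le_ofReal (hcentre _ ?_)) ?_)
      · rw [hnorm _ (by norm_num)]
      · refine mul_le_mul_right ?_ _
        refine (setLIntegral_mono' measurableSet_Ioc fun u hu => ?_).trans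
          (lintegral_mono_set Ioc_subset_Ioi_self)
        have : u • η ∈ E := by
          rw [hE, mem_ofPred_eq, hnorm u (by linarith [hu.1])]
          exact ⟨hu.1, hu.2.trans hsR⟩
        rw [hΦ, indicator_of_mem this]
  set X := ∫⁻ x, Φ x with hX
  have hXE : X = ∫⁻ x in E, ENNReal.ofReal (normPow f p x) * logDer f x :=
    lintegral_indicator hEm _
  have hEsub : ∀ x ∈ E, 0 < ‖x‖ ∧ ‖x‖ < 1 := fun x hx =>
    ⟨lt_trans (by norm_num) hx.1, hx.2.trans_lt hR1⟩
  have hemb : ENNReal.ofReal V * X ≤ ENNReal.ofReal c * ∫⁻ η, G η ∂coneMeasure n := by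
    have := carleson_embedding hn1 hA.le hwm (hCar f hf hf0 hMin hM) hEsub hvm
      (normPow_nonneg f p) (hGm.const_mul (ENNReal.ofReal H)) ?_
    · rw [lintegral_const_mul _ hGm, ← mul_assoc, ← ENNReal.ofReal_mul (by positivity), hVe,
        ← hXE] at this
      exact this
    · intro x hx η hη hd
      obtain ⟨hx0, hx1⟩ := hEsub x hx
      have hd' : ‖‖x‖ • η - x‖ ≤ (1 - ‖x‖) / 2 := by
        have h1 : ‖x‖ • η - x = ‖x‖ • (η - ‖x‖⁻¹ • x) := by
          rw [smul_sub, smul_smul, mul_inv_cancel₀ hx0.ne', one_smul]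
        rw [h1, norm_smul, norm_norm, ← dist_eq_norm]
        have := dist_nonneg (x := η) (y := ‖x‖⁻¹ • x)
        nlinarith
      have h2 := (hMin.harnack (by linarith) hα.le hf0 hx1 hd').2
      refine le_trans ?_ (mul_le_mul_right (hvG η hη ‖x‖ hx0.le hx.2) _)
      rw [← ENNReal.ofReal_mul hH0.le, normPow_of_norm_lt f p hx1, normPow_of_norm_lt f p
        (by rwa [norm_smul, hη, mul_one, norm_norm])]
      exact ENNReal.ofReal_le_ofReal
        (rpow_le_mul_rpow hH hp.le hp1 (norm_nonneg _) (norm_nonneg _) h2)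
  have hGint : ∫⁻ η, G η ∂coneMeasure n ≤
      ENNReal.ofReal (m₀ * S) + ENNReal.ofReal (p * 2 ^ (n - 1)) * X := by
    rw [hG, lintegral_add_left measurable_const, lintegral_const,
      lintegral_const_mul' _ _ ENNReal.ofReal_ne_top, hSe, ← ENNReal.ofReal_mul hm₀0,
      ENNReal.ofReal_mul hp.le, mul_assoc (ENNReal.ofReal p)]
    exact add_le_add le_rfl (mul_le_mul_right (lintegral_radial_le hn1 hΦm) _)
  have hXfin : X ≠ ⊤ := by
    obtain ⟨B, hB⟩ : ∃ B : ℝ, ∀ x ∈ E, normPow f p x ≤ B := by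
      have hsub : closedBall (0 : Vec n) R ⊆ unitBall n := closedBall_subset_ball hR1
      obtain ⟨B, hB⟩ := (isCompact_closedBall (0 : Vec n) R).exists_bound_of_continuousOn
        (hf.1.mono hsub)
      refine ⟨B ^ p, fun x hx => ?_⟩
      rw [normPow_of_norm_lt f p (hEsub x hx).2]
      exact Real.rpow_le_rpow (norm_nonneg _) (hB x (by simpa using hx.2)) hp.le
    obtain ⟨ω, hω⟩ := exists_unit_vec hn1
    have h1 := hCar f hf hf0 hMin hM ω hω 1 one_pos le_rfl
    have h2 : X ≤ ENNReal.ofReal B * ∫⁻ z in {z : Vec n | ‖z‖ < 1 ∧ ‖z - ω‖ < 6 * 1},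
        logDer f z := by
      rw [hXE, ← lintegral_const_mul' _ _ ENNReal.ofReal_ne_top]
      refine (setLIntegral_mono' hEm fun x hx => mul_le_mul_left
        (ENNReal.ofReal_le_ofReal (hB x hx)) _).trans (lintegral_mono_set fun x hx => ?_)
      have := (hEsub x hx).2
      refine ⟨this, ?_⟩
      linarith [norm_sub_le x ω]
    exact ne_top_of_le_ne_top (ENNReal.mul_ne_top ENNReal.ofReal_ne_top
      (ne_top_of_le_ne_top ENNReal.ofReal_ne_top h1)) h2
  have hXe : X = ENNReal.ofReal X.toReal := (ENNReal.ofReal_toReal hXfin).symm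
  have hX0 : 0 ≤ X.toReal := ENNReal.toReal_nonneg
  rw [hXe, ← ENNReal.ofReal_mul (by positivity), ← ENNReal.ofReal_add (by positivity)
    (by positivity)] at hGint
  have habs : V * X.toReal ≤ c * (m₀ * S + p * 2 ^ (n - 1) * X.toReal) := by
    have h1 := hemb.trans (mul_le_mul_right hGint _)
    rw [hXe, ← ENNReal.ofReal_mul hV0.le, ← ENNReal.ofReal_mul hc0.le] at h1
    rw [ENNReal.toReal_ofReal hX0] at h1
    exact (ENNReal.ofReal_le_ofReal_iff (by positivity)).1 h1
  have hfin : p * 2 ^ (n - 1) * X.toReal ≤ m₀ * S := by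
    have h1 : V / 2 * X.toReal ≤ c * (m₀ * S) := by nlinarith
    have h2 : c * (p * 2 ^ (n - 1) * X.toReal) ≤ c * (m₀ * S) := by nlinarith
    exact le_of_mul_le_mul_left h2 hc0
  calc ∫⁻ η, ENNReal.ofReal (normPow f p (R₀ • η)) ∂coneMeasure n
      ≤ ∫⁻ η, G η ∂coneMeasure n := by
        refine lintegral_mono_ae ?_
        filter_upwards [ae_norm_eq_one_coneMeasure n] with η hη using hvG η hη R₀ hR₀ hR₀R
    _ ≤ _ := hGint
    _ ≤ _ := by
        refine ENNReal.ofReal_le_ofReal ?_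
        rw [hm₀] at hfin ⊢
        linarith

/-! ### From the cone measure to the Hausdorff measure -/

theorem sphMeasure_ball_eq {n : ℕ} {ω η : Vec n} (hω : ‖ω‖ = 1) (hη : ‖η‖ = 1) (ε : ℝ) :
    sphMeasure n (ball ω ε) = sphMeasure n (ball η ε) := by
  obtain ⟨L, hL⟩ : ∃ L : Vec n ≃ₗᵢ[ℝ] Vec n, L ω = η :=
    ⟨_, Submodule.reflection_sub (hω.trans hη.symm)⟩
  rw [sphMeasure, Measure.restrict_apply measurableSet_ball,
    Measure.restrict_apply measurableSet_ball,
    ← L.toIsometryEquiv.hausdorffMeasure_preimage _ (ball η ε ∩ unitSphere n)]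
  congr 1
  ext x
  have h1 : L.symm η = ω := by rw [← hL, L.symm_apply_apply]
  simp [unitSphere, h1]

theorem ae_norm_eq_one_sphMeasure (n : ℕ) : ∀ᵐ ω ∂sphMeasure n, ‖ω‖ = 1 := by
  filter_upwards [ae_restrict_mem (isClosed_sphere (x := (0 : Vec n)) (ε := 1)).measurableSet]
    with ω hω
  simpa [unitSphere] using hω

theorem lintegral_mul_measure_ball_comm {X : Type*} [PseudoMetricSpace X] [MeasurableSpace X]
    [OpensMeasurableSpace X] [SecondCountableTopology X] (μ ν : Measure X) [SFinite μ] [SFinite ν]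
    {h : X → ℝ≥0∞} (hh : Measurable h) (ε : ℝ) :
    ∫⁻ x, (∫⁻ y in ball x ε, h y ∂ν) ∂μ = ∫⁻ y, h y * μ (ball y ε) ∂ν := by
  have hm : Measurable fun q : X × X => {q : X × X | dist q.1 q.2 < ε}.indicator
      (fun q => h q.2) q :=
    Measurable.indicator (by fun_prop) (measurableSet_lt (by fun_prop) (by fun_prop))
  have h1 : ∀ x, ∫⁻ y in ball x ε, h y ∂ν = ∫⁻ y, {q : X × X | dist q.1 q.2 < ε}.indicator
      (fun q => h q.2) (x, y) ∂ν := fun x => by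
    rw [← lintegral_indicator measurableSet_ball]
    refine lintegral_congr fun y => ?_
    simp [indicator, dist_comm]
  simp_rw [h1]
  rw [lintegral_lintegral_swap hm.aemeasurable]
  refine lintegral_congr fun y => ?_
  rw [← lintegral_indicator_one measurableSet_ball, ← lintegral_const_mul _
    (measurable_one.indicator measurableSet_ball)]
  refine lintegral_congr fun x => ?_
  simp [indicator]

/-- Spherical means against surface measure are controlled by means against the cone measure, for
functions satisfying a Harnack inequality at some scale. -/
theorem sphMeasure_mean_le {n : ℕ} (hn : 1 ≤ n) {h : Vec n → ℝ≥0∞} (hh : Measurable h) {c : ℝ≥0∞}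
    {ε : ℝ} (hε : 0 < ε)
    (hc : ∀ ω η : Vec n, ‖ω‖ = 1 → ‖η‖ = 1 → dist ω η < ε → h ω ≤ c * h η) :
    (sphMeasure n (unitSphere n))⁻¹ * ∫⁻ ω, h ω ∂sphMeasure n ≤
      c * ((coneMeasure n univ)⁻¹ * ∫⁻ η, h η ∂coneMeasure n) := by
  have huniv : sphMeasure n univ = sphMeasure n (unitSphere n) := by
    simp [sphMeasure]
  by_cases hfin : sphMeasure n (unitSphere n) = ⊤
  · simp [hfin]
  by_cases hzero : sphMeasure n (unitSphere n) = 0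
  · have : sphMeasure n = 0 := Measure.measure_univ_eq_zero.1 (huniv.trans hzero)
    simp [this]
  have : IsFiniteMeasure (sphMeasure n) := ⟨by rw [huniv]; exact lt_top_iff_ne_top.2 hfin⟩
  obtain ⟨ω₀, hω₀⟩ := exists_unit_vec hn
  set mτ := coneMeasure n (ball ω₀ ε) with hmτ
  set mσ := sphMeasure n (ball ω₀ ε) with hmσ
  have hmτ0 : mτ ≠ 0 := by
    have h1 := le_coneMeasure_ball hn hω₀ (ρ := min ε 1) (lt_min hε one_pos) (min_le_right _ _)
    intro h0
    have h2 : coneMeasure n (ball ω₀ (min ε 1)) = 0 :=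
      measure_mono_null (ball_subset_ball (min_le_left _ _)) h0
    rw [h2, mul_zero, nonpos_iff_eq_zero, mul_eq_zero] at h1
    rcases h1 with h1 | h1
    · have : 0 < (min ε 1) ^ (n - 1) := pow_pos (lt_min hε one_pos) _
      rw [ENNReal.ofReal_eq_zero] at h1
      linarith
    · exact (measure_ball_pos _ _ one_pos).ne' h1
  have hmτt : mτ ≠ ⊤ := measure_ne_top _ _
  have htot : mσ * coneMeasure n univ = mτ * sphMeasure n (unitSphere n) := by
    have h1 := lintegral_mul_measure_ball_comm (sphMeasure n) (coneMeasure n)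
      (measurable_const : Measurable fun _ : Vec n => (1 : ℝ≥0∞)) ε
    have h2 : ∫⁻ x, (∫⁻ _ in ball x ε, 1 ∂coneMeasure n) ∂sphMeasure n
        = mτ * sphMeasure n (unitSphere n) := by
      rw [← huniv, ← lintegral_const]
      refine lintegral_congr_ae ?_
      filter_upwards [ae_norm_eq_one_sphMeasure n] with ω hω
      rw [setLIntegral_one, coneMeasure_ball_eq hn hω hω₀]
    have h3 : ∫⁻ y, 1 * sphMeasure n (ball y ε) ∂coneMeasure n = mσ * coneMeasure n univ := by
      rw [← lintegral_const]
      refine lintegral_congr_ae ?_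
      filter_upwards [ae_norm_eq_one_coneMeasure n] with ω hω
      rw [one_mul, sphMeasure_ball_eq hω hω₀]
    rw [← h2, ← h3, h1]
  have hmain : mτ * ∫⁻ ω, h ω ∂sphMeasure n ≤ c * (mσ * ∫⁻ η, h η ∂coneMeasure n) := by
    calc mτ * ∫⁻ ω, h ω ∂sphMeasure n
        = ∫⁻ ω, (∫⁻ _ in ball ω ε, h ω ∂coneMeasure n) ∂sphMeasure n := by
          rw [← lintegral_const_mul _ hh]
          refine lintegral_congr_ae ?_
          filter_upwards [ae_norm_eq_one_sphMeasure n] with ω hω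
          rw [setLIntegral_const, coneMeasure_ball_eq hn hω hω₀, mul_comm]
      _ ≤ ∫⁻ ω, (∫⁻ η in ball ω ε, c * h η ∂coneMeasure n) ∂sphMeasure n := by
          refine lintegral_mono_ae ?_
          filter_upwards [ae_norm_eq_one_sphMeasure n] with ω hω
          refine lintegral_mono_ae ?_
          filter_upwards [ae_restrict_of_ae (ae_norm_eq_one_coneMeasure n),
            ae_restrict_mem measurableSet_ball] with η hη hmem
          exact hc ω η hω hη (by rwa [dist_comm])
      _ = ∫⁻ η, c * h η * sphMeasure n (ball η ε) ∂coneMeasure n :=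
          lintegral_mul_measure_ball_comm _ _ (hh.const_mul c) ε
      _ = ∫⁻ η, c * mσ * h η ∂coneMeasure n := by
          refine lintegral_congr_ae ?_
          filter_upwards [ae_norm_eq_one_coneMeasure n] with η hη
          rw [sphMeasure_ball_eq hη hω₀, mul_right_comm]
      _ = _ := by rw [lintegral_const_mul _ hh, mul_assoc]
  have hτ0 := coneMeasure_univ_ne_zero hn
  have hτt : coneMeasure n univ ≠ ⊤ := measure_ne_top _ _
  refine (ENNReal.mul_le_mul_iff_right (mul_ne_zero hmτ0 hzero) (ENNReal.mul_ne_top hmτt hfin)).1 ?_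
  calc mτ * sphMeasure n (unitSphere n) *
        ((sphMeasure n (unitSphere n))⁻¹ * ∫⁻ ω, h ω ∂sphMeasure n)
      = sphMeasure n (unitSphere n) * (sphMeasure n (unitSphere n))⁻¹ *
          (mτ * ∫⁻ ω, h ω ∂sphMeasure n) := by ring
    _ = mτ * ∫⁻ ω, h ω ∂sphMeasure n := by rw [ENNReal.mul_inv_cancel hzero hfin, one_mul]
    _ ≤ _ := hmain
    _ = coneMeasure n univ * (coneMeasure n univ)⁻¹ *
          (c * (mσ * ∫⁻ η, h η ∂coneMeasure n)) := by
        rw [ENNReal.mul_inv_cancel hτ0 hτt, one_mul]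
    _ = _ := by rw [← htot]; ring

theorem jerison_weitsman_qr (n : ℕ) (hn : 2 ≤ n) (K C₀ α a C₁ : ℝ)
    (hK : 1 ≤ K) (hC₀ : 1 ≤ C₀) (hα : 0 < α) (ha0 : 0 ≤ a) (ha : a < (n : ℝ) - 1)
    (hC₁ : 0 < C₁) :
    ∃ p C : ℝ, 0 < p ∧ 0 < C ∧ ∀ f : Vec n → Vec n,
      IsQR n K f → (∀ x ∈ unitBall n, f x ≠ 0) →
      InMiniowitz n C₀ α f → MultCond n a C₁ f →
      hardyNorm n p f ≤ ENNReal.ofReal (C * ‖f 0‖) ∧ MemHp n p f := by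
  have hn1 : 1 ≤ n := by omega
  obtain ⟨p, C, hp, hp1, hC, hbound⟩ :=
    exists_coneMeasure_mean_bound hn hK hC₀ hα ha0 ha hC₁
  have hH := one_le_mul_six_rpow hC₀ hα.le
  set H := C₀ * 6 ^ α with hHdef
  set S := (coneMeasure n univ).toReal with hS
  have hSe : coneMeasure n univ = ENNReal.ofReal S :=
    (ENNReal.ofReal_toReal (measure_ne_top _ _)).symm
  have hS0 : 0 < S := ENNReal.toReal_pos (coneMeasure_univ_ne_zero hn1) (measure_ne_top _ _)
  have hD : 0 < H * (S⁻¹ * C) := by positivity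
  refine ⟨p, (H * (S⁻¹ * C)) ^ (1 / p), hp, by positivity, fun f hf hf0 hMin hM => ?_⟩
  have hmean : ∀ r ∈ Ioo (0 : ℝ) 1,
      hardyMean n p f r ≤ ENNReal.ofReal (H * (S⁻¹ * C) * ‖f 0‖ ^ p) := by
    rintro r ⟨hr0, hr1⟩
    have hnorm : ∀ ω : Vec n, ‖ω‖ = 1 → ‖r • ω‖ = r := fun ω hω => by
      rw [norm_smul, hω, mul_one, Real.norm_eq_abs, abs_of_pos hr0]
    have hvm := measurable_normPow hf.1 p
    have hcongr : ∫⁻ ω, ENNReal.ofReal (‖f (r • ω)‖ ^ p) ∂sphMeasure n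
        = ∫⁻ ω, ENNReal.ofReal (normPow f p (r • ω)) ∂sphMeasure n := by
      refine lintegral_congr_ae ?_
      filter_upwards [ae_norm_eq_one_sphMeasure n] with ω hω
      rw [normPow_of_norm_lt f p (by rwa [hnorm ω hω])]
    rw [hardyMean, hcongr]
    refine (sphMeasure_mean_le hn1 (by fun_prop) (c := ENNReal.ofReal H)
      (ε := (1 - r) / 2) (by linarith) ?_).trans ?_
    · intro ω η hω hη hd
      rw [← ENNReal.ofReal_mul (by linarith), normPow_of_norm_lt f p (by rwa [hnorm ω hω]),
        normPow_of_norm_lt f p (by rwa [hnorm η hη])]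
      refine ENNReal.ofReal_le_ofReal
        (rpow_le_mul_rpow hH hp.le hp1 (norm_nonneg _) (norm_nonneg _) ?_)
      refine (hMin.harnack (by linarith) hα.le hf0 (by rwa [hnorm η hη]) ?_).1
      rw [hnorm η hη, ← smul_sub, norm_smul, Real.norm_eq_abs, abs_of_pos hr0, ← dist_eq_norm]
      nlinarith [dist_nonneg (x := ω) (y := η)]
    · calc _ ≤ ENNReal.ofReal H * ((coneMeasure n univ)⁻¹ * ENNReal.ofReal (C * ‖f 0‖ ^ p)) := by
            gcongr
            exact hbound f hf hf0 hMin hM r hr0.le hr1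
        _ = _ := by
            rw [hSe, ← ENNReal.ofReal_inv_of_pos hS0, ← ENNReal.ofReal_mul (by positivity),
              ← ENNReal.ofReal_mul (by positivity)]
            congr 1
            ring
  have hnorm : hardyNorm n p f ≤ ENNReal.ofReal ((H * (S⁻¹ * C)) ^ (1 / p) * ‖f 0‖) := by
    calc hardyNorm n p f ≤ ENNReal.ofReal (H * (S⁻¹ * C) * ‖f 0‖ ^ p) ^ (1 / p) :=
          ENNReal.rpow_le_rpow (iSup₂_le hmean) (by positivity)
      _ = _ := by
          rw [ENNReal.ofReal_rpow_of_nonneg (by positivity) (by positivity),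
            Real.mul_rpow hD.le (by positivity), one_div,
            Real.rpow_rpow_inv (norm_nonneg _) hp.ne']
  exact ⟨hnorm, hnorm.trans_lt ENNReal.ofReal_lt_top⟩

end
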